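/- arXiv:1405.5391 — 2 statements merged into one kernel-verified Lean document; each statement's English description precedes it below -/
import Mathlib

section
/- (Theorem B, Abhyankar–Moh–Suzuki, curve form.) Let f ∈ ℂ[X,Y] be an irreducible polynomial such that the quotient ring ℂ[X,Y]/(f) is isomorphic as a ℂ-algebra to the polynomial ring ℂ[t] in one variable (i.e., the curve Z(f) is isomorphic to the affine line ℂ¹). Then there exists a ℂ-algebra automorphism σ of ℂ[X,Y] with σ(f) = X. In other words, in some algebraic coordinates on ℂ² the curve has equation X = 0. -/
open MvPolynomial

namespace Polynomial

section Gauss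

variable {E : Type*} [Field E] {v : AbsoluteValue E ℝ}

/-- The Gauss norm on the closed disc of radius `b` around `a`. -/
noncomputable def discNorm (v : AbsoluteValue E ℝ) (b : ℝ) (a : E) (p : E[X]) : ℝ :=
  (taylor a p).gaussNorm v b

lemma discNorm_nonneg {b : ℝ} (hb : 0 < b) (a : E) (p : E[X]) : 0 ≤ discNorm v b a p :=
  gaussNorm_nonneg v _ hb.le

lemma discNorm_zero (b : ℝ) (a : E) : discNorm v b a 0 = 0 := by
  simp [discNorm]

lemma discNorm_C (b : ℝ) (a r : E) : discNorm v b a (C r) = v r := by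
  rw [discNorm, taylor_C, gaussNorm_C]

lemma discNorm_add_le (hv : IsNonarchimedean v) {b : ℝ} (hb : 0 < b) (a : E) (p q : E[X]) :
    discNorm v b a (p + q) ≤ max (discNorm v b a p) (discNorm v b a q) := by
  rw [discNorm, map_add]
  exact isNonarchimedean_gaussNorm v hv hb.le _ _

lemma discNorm_mul (hv : IsNonarchimedean v) {b : ℝ} (hb : 0 < b) (a : E) (p q : E[X]) :
    discNorm v b a (p * q) = discNorm v b a p * discNorm v b a q := by
  rw [discNorm, taylor_mul, gaussNorm_mul hv hb]
  rfl

lemma discNorm_neg (hv : IsNonarchimedean v) {b : ℝ} (hb : 0 < b) (a : E) (p : E[X]) :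
    discNorm v b a (-p) = discNorm v b a p := by
  have : -p = C (-1) * p := by simp
  rw [this, discNorm_mul hv hb, discNorm_C]
  simp

lemma discNorm_sub_le (hv : IsNonarchimedean v) {b : ℝ} (hb : 0 < b) (a : E) (p q : E[X]) :
    discNorm v b a (p - q) ≤ max (discNorm v b a p) (discNorm v b a q) := by
  rw [sub_eq_add_neg, ← discNorm_neg hv hb a q]
  exact discNorm_add_le hv hb a p (-q)

lemma discNorm_pow (hv : IsNonarchimedean v) {b : ℝ} (hb : 0 < b) (a : E) (p : E[X]) (k : ℕ) :
    discNorm v b a (p ^ k) = discNorm v b a p ^ k := by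
  induction k with
  | zero => rw [pow_zero, pow_zero, ← C_1, discNorm_C, map_one]
  | succ k ih => rw [pow_succ, pow_succ, discNorm_mul hv hb, ih]

lemma discNorm_prod (hv : IsNonarchimedean v) {b : ℝ} (hb : 0 < b) (a : E) {ι : Type*}
    (s : Finset ι) (p : ι → E[X]) :
    discNorm v b a (∏ i ∈ s, p i) = ∏ i ∈ s, discNorm v b a (p i) := by
  classical
  induction s using Finset.induction_on with
  | empty => rw [Finset.prod_empty, Finset.prod_empty, ← C_1, discNorm_C, map_one]
  | insert i s hi ih => rw [Finset.prod_insert hi, Finset.prod_insert hi, discNorm_mul hv hb, ih]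

lemma discNorm_sum_le (hv : IsNonarchimedean v) {b : ℝ} (hb : 0 < b) (a : E) {ι : Type*}
    (s : Finset ι) (p : ι → E[X]) {R : ℝ} (hR : 0 ≤ R) (h : ∀ i ∈ s, discNorm v b a (p i) ≤ R) :
    discNorm v b a (∑ i ∈ s, p i) ≤ R := by
  classical
  induction s using Finset.induction_on with
  | empty => simpa [discNorm_zero] using hR
  | insert i s hi ih =>
    rw [Finset.sum_insert hi]
    refine (discNorm_add_le hv hb a _ _).trans (max_le (h i (by simp)) (ih fun j hj ↦ h j ?_))
    simp [hj]

lemma discNorm_X_sub_C {b : ℝ} (hb : 0 < b) (a u : E) :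
    discNorm v b a (X - C u) = max b (v (a - u)) := by
  have h : taylor a (X - C u) = X + C (a - u) := by
    rw [map_sub, taylor_X, taylor_C, C_sub]; ring
  rw [discNorm, h]
  generalize a - u = w
  apply le_antisymm
  · obtain ⟨i, hi⟩ := exists_eq_gaussNorm v b (X + C w)
    rw [hi]
    rcases i with _ | _ | i
    · simp
    · simp
    · simp [coeff_X, hb.le]
  · refine max_le ?_ ?_
    · have h1 := le_gaussNorm v (X + C w) hb.le 1
      rwa [coeff_add, coeff_X_one, coeff_C_succ, add_zero, map_one, one_mul, pow_one] at h1
    · have h0 := le_gaussNorm v (X + C w) hb.le 0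
      rwa [coeff_add, coeff_X_zero, coeff_C_zero, zero_add, pow_zero, mul_one] at h0

lemma eval_le_discNorm {b : ℝ} (hb : 0 < b) (a : E) (p : E[X]) :
    v (p.eval a) ≤ discNorm v b a p := by
  simpa [discNorm] using le_gaussNorm v (taylor a p) hb.le 0

end Gauss

section Division

open Lagrange

variable {E : Type*} [Field E] {v : AbsoluteValue E ℝ} {ι : Type*} [Fintype ι] [DecidableEq ι]
  {a : ι → E} {b D : ℝ}

lemma discNorm_basis_le (hv : IsNonarchimedean v) (hb : 0 < b)
    (ha : ∀ i j, i ≠ j → b ≤ v (a i - a j))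
    (hF : ∀ i, discNorm v b (a i) (nodal Finset.univ a) = D) (i j : ι) :
    discNorm v b (a j) (Lagrange.basis Finset.univ a i) ≤ 1 := by
  have hinj : Function.Injective a := fun i j h ↦ by
    by_contra hij
    have := ha i j hij
    rw [h, sub_self, map_zero] at this
    linarith
  have hprod : discNorm v b (a i) (nodal (Finset.univ.erase i) a)
      = v (eval (a i) (nodal (Finset.univ.erase i) a)) := by
    rw [nodal, discNorm_prod hv hb, eval_prod, map_prod]
    refine Finset.prod_congr rfl fun k hk ↦ ?_
    rw [discNorm_X_sub_C hb, max_eq_right (ha i k (Finset.ne_of_mem_erase hk).symm)]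
    simp
  have hmul (k : ι) : D = max b (v (a k - a i)) *
      discNorm v b (a k) (nodal (Finset.univ.erase i) a) := by
    rw [← discNorm_X_sub_C hb, ← discNorm_mul hv hb, ← nodal_eq_mul_nodal_erase (Finset.mem_univ i),
      hF]
  have hne : eval (a i) (nodal (Finset.univ.erase i) a) ≠ 0 :=
    eval_nodal_not_at_node fun k hk h ↦ Finset.ne_of_mem_erase hk (hinj h).symm
  have hpos := v.pos hne
  rw [basis_eq_prod_sub_inv_mul_nodal_div (Finset.mem_univ i),
    ← nodal_erase_eq_nodal_div (Finset.mem_univ i), nodalWeight_eq_eval_nodal_erase_inv,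
    discNorm_mul hv hb, discNorm_C, map_inv₀, inv_mul_le_iff₀ hpos, mul_one, ← hprod]
  have h1 := hmul i
  have h2 := hmul j
  rw [sub_self, map_zero, max_eq_left hb.le] at h1
  have h3 : b * discNorm v b (a j) (nodal (Finset.univ.erase i) a) ≤
      max b (v (a j - a i)) * discNorm v b (a j) (nodal (Finset.univ.erase i) a) :=
    mul_le_mul_of_nonneg_right (le_max_left _ _) (discNorm_nonneg hb _ _)
  rw [← h2, h1] at h3
  exact le_of_mul_le_mul_left h3 hb

lemma discNorm_modByMonic_nodal_le (hv : IsNonarchimedean v) (hb : 0 < b)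
    (ha : ∀ i j, i ≠ j → b ≤ v (a i - a j))
    (hF : ∀ i, discNorm v b (a i) (nodal Finset.univ a) = D) {A : E[X]} {R : ℝ} (hR : 0 ≤ R)
    (hA : ∀ i, discNorm v b (a i) A ≤ R) (j : ι) :
    discNorm v b (a j) (A %ₘ nodal Finset.univ a) ≤ R := by
  have hinj : Set.InjOn a (Finset.univ : Finset ι) := fun i _ j _ h ↦ by
    by_contra hij
    have := ha i j hij
    rw [h, sub_self, map_zero] at this
    linarith
  have hdeg : (A %ₘ nodal Finset.univ a).degree < (Finset.univ : Finset ι).card := by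
    rw [← degree_nodal (R := E) (s := Finset.univ) (v := a)]
    exact degree_modByMonic_lt _ nodal_monic
  rw [eq_interpolate hinj hdeg, interpolate_apply]
  refine discNorm_sum_le hv hb _ _ _ hR fun i _ ↦ ?_
  rw [discNorm_mul hv hb, discNorm_C]
  have h1 : v (eval (a i) (A %ₘ nodal Finset.univ a)) ≤ R := by
    have h2 : eval (a i) (A %ₘ nodal Finset.univ a) = eval (a i) A := by
      conv_rhs => rw [← modByMonic_add_div A (nodal Finset.univ a)]
      simp [eval_nodal_at_node]
    rw [h2]
    exact (eval_le_discNorm hb _ _).trans (hA i)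
  calc _ ≤ R * 1 := mul_le_mul h1 (discNorm_basis_le hv hb ha hF i j) (discNorm_nonneg hb _ _) hR
    _ = R := mul_one R

lemma discNorm_divByMonic_nodal_le (hv : IsNonarchimedean v) (hb : 0 < b) (hD : 0 < D)
    (ha : ∀ i j, i ≠ j → b ≤ v (a i - a j))
    (hF : ∀ i, discNorm v b (a i) (nodal Finset.univ a) = D) {A : E[X]} {R : ℝ} (hR : 0 ≤ R)
    (hA : ∀ i, discNorm v b (a i) A ≤ R) (j : ι) :
    discNorm v b (a j) (A /ₘ nodal Finset.univ a) ≤ R / D := by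
  have h : nodal Finset.univ a * (A /ₘ nodal Finset.univ a) = A - A %ₘ nodal Finset.univ a := by
    rw [eq_sub_iff_add_eq', modByMonic_add_div]
  rw [le_div_iff₀' hD, ← hF j, ← discNorm_mul hv hb, h]
  exact (discNorm_sub_le hv hb _ _ _).trans
    (max_le (hA j) (discNorm_modByMonic_nodal_le hv hb ha hF hR hA j))

/-- Division by a power of the nodal polynomial, with control of the quotient. -/
lemma exists_quotient_nodal_pow (hv : IsNonarchimedean v) (hb : 0 < b) (hD : 0 < D)
    (ha : ∀ i j, i ≠ j → b ≤ v (a i - a j))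
    (hF : ∀ i, discNorm v b (a i) (nodal Finset.univ a) = D) (k : ℕ) {A : E[X]} {R : ℝ} (hR : 0 ≤ R)
    (hA : ∀ i, discNorm v b (a i) A ≤ R) :
    ∃ q r : E[X], A = q * nodal Finset.univ a ^ k + r ∧
      r.degree < (k * Fintype.card ι : ℕ) ∧ ∀ i, discNorm v b (a i) q ≤ R / D ^ k := by
  induction k generalizing A R with
  | zero => exact ⟨A, 0, by simp, by simp, by simpa using hA⟩
  | succ k ih =>
    obtain ⟨q, r, h1, h2, h3⟩ := ih (div_nonneg hR hD.le)
      (fun i ↦ discNorm_divByMonic_nodal_le hv hb hD ha hF hR hA i)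
    refine ⟨q, r * nodal Finset.univ a + A %ₘ nodal Finset.univ a, ?_, ?_, ?_⟩
    · conv_lhs => rw [← modByMonic_add_div A (nodal Finset.univ a), h1]
      ring
    · have h4 : (A %ₘ nodal Finset.univ a).degree < (Fintype.card ι : ℕ) := by
        have := degree_modByMonic_lt A (nodal_monic (s := Finset.univ) (v := a))
        rwa [degree_nodal] at this
      refine (degree_add_le _ _).trans_lt (max_lt ?_ ?_)
      · by_cases hr : r = 0
        · rw [hr, zero_mul, degree_zero]
          exact WithBot.bot_lt_coe _
        rw [degree_mul, degree_nodal, degree_eq_natDegree hr, Finset.card_univ, ← Nat.cast_add,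
          Nat.cast_lt]
        rw [degree_eq_natDegree hr, Nat.cast_lt] at h2
        linarith
      · refine h4.trans_le ?_
        rw [Nat.cast_le]
        exact Nat.le_mul_of_pos_left _ k.succ_pos
    · intro i
      rw [pow_succ, mul_comm (D ^ k), ← div_div]
      exact h3 i

end Division

section ApproximateRoot

variable {R : Type*} [CommRing R]

/-- One correction step in the construction of an approximate `d`-th root. -/
lemma degree_sub_add_pow_lt [Nontrivial R] {F G P S T e : R[X]} {N d r : ℕ} (hF : F.Monic)
    (hFN : F.natDegree = N) (hG : G.Monic) (hGN : G.natDegree = N) (hr : r < N)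
    (hPG : P - G ^ (d + 1) = S * F ^ d + T)
    (hT : T.degree < (N * d : ℕ)) (hS : S.degree < (r + 1 : ℕ)) (he : (d + 1 : R[X]) * e = S)
    (hdeg : e.degree < (r + 1 : ℕ)) :
    (P - (G + e) ^ (d + 1)).degree < (N * d + r : ℕ) := by
  have hN : 0 < N := by omega
  have h1 : P - (G + e) ^ (d + 1)
      = T + (S * (F ^ d - G ^ d) - ((G + e) ^ (d + 1) - G ^ (d + 1) - (d + 1) * G ^ d * e)) := by
    rw [← he] at hPG ⊢
    linear_combination hPG
  have h2 : T.degree < (N * d + r : ℕ) := hT.trans_le (by exact_mod_cast Nat.le_add_right _ _)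
  have hdegpow (k : ℕ) (H : R[X]) (hH : H.Monic) (hHN : H.natDegree = N) :
      (H ^ k).degree = (N * k : ℕ) := by
    rw [degree_eq_natDegree (hH.pow k).ne_zero, hH.natDegree_pow, hHN, mul_comm]
  have h3 : (S * (F ^ d - G ^ d)).degree < (N * d + r : ℕ) := by
    rcases Nat.eq_zero_or_pos d with rfl | hd
    · simp
    have h4 : (F ^ d - G ^ d).degree < (N * d : ℕ) := by
      rw [← hdegpow d F hF hFN]
      apply degree_sub_lt_left
      · rw [hdegpow d F hF hFN, hdegpow d G hG hGN]
      · exact (hF.pow d).ne_zero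
      · rw [(hF.pow d).leadingCoeff, (hG.pow d).leadingCoeff]
    by_cases h5 : S = 0
    · rw [h5, zero_mul, degree_zero]; exact WithBot.bot_lt_coe _
    by_cases h6 : F ^ d - G ^ d = 0
    · rw [h6, mul_zero, degree_zero]; exact WithBot.bot_lt_coe _
    refine (degree_mul_le _ _).trans_lt ?_
    rw [degree_eq_natDegree h5, degree_eq_natDegree h6] at *
    norm_cast at *
    omega
  have h4 : ((G + e) ^ (d + 1) - G ^ (d + 1) - (d + 1) * G ^ d * e).degree
      < (N * d + r : ℕ) := by
    rw [add_pow, Finset.sum_range_succ, Finset.sum_range_succ]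
    have : ∑ x ∈ Finset.range d, G ^ x * e ^ (d + 1 - x) * ((d + 1).choose x : R[X]) +
        G ^ d * e ^ (d + 1 - d) * ((d + 1).choose d : R[X]) +
        G ^ (d + 1) * e ^ (d + 1 - (d + 1)) * ((d + 1).choose (d + 1) : R[X]) - G ^ (d + 1) -
        (d + 1) * G ^ d * e
        = ∑ x ∈ Finset.range d, G ^ x * e ^ (d + 1 - x) * ((d + 1).choose x : R[X]) := by
      rw [Nat.choose_self, Nat.choose_succ_self_right, Nat.sub_self, Nat.add_sub_cancel_left]
      push_cast
      ring
    rw [this]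
    refine (degree_sum_le _ _).trans_lt ((Finset.sup_lt_iff (WithBot.bot_lt_coe _)).2 fun x hx ↦ ?_)
    have hxd : x < d := Finset.mem_range.1 hx
    by_cases h5 : e = 0
    · rw [h5, zero_pow (by omega), mul_zero, zero_mul, degree_zero]; exact WithBot.bot_lt_coe _
    have h7 : (e ^ (d + 1 - x)).natDegree ≤ (d + 1 - x) * e.natDegree := natDegree_pow_le
    have h8 : (G ^ x * e ^ (d + 1 - x) * ((d + 1).choose x : R[X])).natDegree ≤
        x * N + (d + 1 - x) * e.natDegree := by
      refine natDegree_mul_le.trans ?_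
      rw [natDegree_natCast, add_zero]
      refine natDegree_mul_le.trans (add_le_add ?_ h7)
      rw [hG.natDegree_pow, hGN]
    refine degree_le_natDegree.trans_lt ?_
    rw [degree_eq_natDegree h5] at hdeg
    norm_cast at hdeg ⊢
    refine h8.trans_lt ?_
    obtain ⟨k, rfl⟩ : ∃ k, d = x + 1 + k := ⟨d - x - 1, by omega⟩
    have h9 : x + 1 + k + 1 - x = k + 2 := by omega
    have h10 : (k + 2) * e.natDegree ≤ (k + 2) * r := Nat.mul_le_mul_left _ (by omega)
    have h11 : (k + 1) * r < (k + 1) * N := Nat.mul_lt_mul_of_pos_left hr (by omega)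
    rw [h9]
    nlinarith
  rw [h1]
  refine (degree_add_le _ _).trans_lt (max_lt h2 ?_)
  exact (degree_sub_le _ _).trans_lt (max_lt h3 h4)

/-- Existence of an approximate `(d+1)`-st root of a monic polynomial, with a side condition that
is preserved by the correction steps. -/
lemma exists_approximateRoot_of [Nontrivial R] {F P : R[X]} {N d : ℕ} (hF : F.Monic)
    (hFN : F.natDegree = N) (hP : P.Monic) (hPN : P.natDegree = N * (d + 1))
    (hd : IsUnit ((d + 1 : ℕ) : R)) (p : R[X] → Prop) (hpF : p F)
    (hstep : ∀ G, p G → G.Monic → G.natDegree = N → ∃ S T : R[X], P - G ^ (d + 1) = S * F ^ d + T ∧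
      T.degree < (N * d : ℕ) ∧ ∀ e, (d + 1 : R[X]) * e = S → p (G + e)) :
    ∃ Q : R[X], p Q ∧ Q.Monic ∧ Q.natDegree = N ∧ (P - Q ^ (d + 1)).degree < (N * d : ℕ) := by
  rcases Nat.eq_zero_or_pos N with hN | hN
  · subst hN
    rw [zero_mul] at hPN
    refine ⟨F, hpF, hF, hFN, ?_⟩
    rw [eq_one_of_monic_natDegree_zero hF hFN, eq_one_of_monic_natDegree_zero hP hPN]
    simp
  suffices h : ∀ k ≤ N, ∃ Q : R[X], p Q ∧ Q.Monic ∧ Q.natDegree = N ∧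
      (P - Q ^ (d + 1)).degree < (N * d + (N - k) : ℕ) by simpa using h N le_rfl
  intro k
  induction k with
  | zero =>
    refine fun _ ↦ ⟨F, hpF, hF, hFN, ?_⟩
    have h1 : P.degree = (N * d + (N - 0) : ℕ) := by
      rw [degree_eq_natDegree hP.ne_zero, hPN]; congr 1
    rw [← h1]
    apply degree_sub_lt_left
    · rw [h1, degree_eq_natDegree (hF.pow _).ne_zero, hF.natDegree_pow, hFN]
      norm_cast
      simp only [Nat.sub_zero]; ring
    · exact hP.ne_zero
    · rw [hP.leadingCoeff, (hF.pow _).leadingCoeff]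
  | succ k ih =>
    intro hk
    obtain ⟨Q, hpQ, hQ, hQN, hPQ⟩ := ih (by omega)
    obtain ⟨S, T, h1, h2, h3⟩ := hstep Q hpQ hQ hQN
    obtain ⟨u, hu⟩ := hd
    have hr : N - k = (N - (k + 1)) + 1 := by omega
    rw [hr] at hPQ
    set r := N - (k + 1) with hrdef
    have hS : S.degree < (r + 1 : ℕ) := by
      have h4 : (S * F ^ d).degree < (N * d + (r + 1) : ℕ) := by
        have h5 : S * F ^ d = (P - Q ^ (d + 1)) - T := by rw [h1]; ring
        rw [h5]
        exact (degree_sub_le _ _).trans_lt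
          (max_lt hPQ (h2.trans_le (by exact_mod_cast Nat.le_add_right _ _)))
      rw [(hF.pow d).degree_mul, degree_eq_natDegree (hF.pow d).ne_zero, hF.natDegree_pow, hFN] at h4
      by_cases h6 : S = 0
      · rw [h6, degree_zero]; exact WithBot.bot_lt_coe _
      rw [degree_eq_natDegree h6] at h4 ⊢
      norm_cast at h4 ⊢
      rw [mul_comm d N] at h4
      omega
    have hee : (d + 1 : R[X]) * (C (↑u⁻¹ : R) * S) = S := by
      have : (d + 1 : R[X]) = C (u : R) := by rw [hu]; simp
      rw [this, ← mul_assoc, ← C_mul, Units.mul_inv, C_1, one_mul]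
    have hedeg : (C (↑u⁻¹ : R) * S).degree < (r + 1 : ℕ) := by
      refine lt_of_le_of_lt ?_ hS
      rw [← smul_eq_C_mul]
      exact degree_smul_le _ _
    have hlt : (C (↑u⁻¹ : R) * S).degree < Q.degree := by
      refine hedeg.trans_le ?_
      rw [degree_eq_natDegree hQ.ne_zero, hQN]
      exact_mod_cast (by omega : r + 1 ≤ N)
    refine ⟨Q + C (↑u⁻¹ : R) * S, h3 _ hee, hQ.add_of_left hlt, ?_, ?_⟩
    · rw [natDegree_add_eq_left_of_degree_lt hlt, hQN]
    · exact degree_sub_add_pow_lt hF hFN hQ hQN (by omega) h1 h2 hS hee hedeg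

/-- Existence of an approximate `(d+1)`-st root of a monic polynomial. -/
lemma exists_approximateRoot [Nontrivial R] {P : R[X]} {N d : ℕ} (hP : P.Monic)
    (hPN : P.natDegree = N * (d + 1)) (hd : IsUnit ((d + 1 : ℕ) : R)) :
    ∃ Q : R[X], Q.Monic ∧ Q.natDegree = N ∧ (P - Q ^ (d + 1)).degree < (N * d : ℕ) := by
  have hX : (X ^ N : R[X]).Monic := monic_X_pow N
  obtain ⟨Q, -, hQ⟩ := exists_approximateRoot_of hX (natDegree_X_pow N) hP hPN hd (fun _ ↦ True)
    trivial fun G _ _ _ ↦ by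
      refine ⟨(P - G ^ (d + 1)) /ₘ (X ^ N) ^ d, (P - G ^ (d + 1)) %ₘ (X ^ N) ^ d, ?_, ?_,
        fun _ _ ↦ trivial⟩
      · conv_lhs => rw [← modByMonic_add_div (P - G ^ (d + 1)) ((X ^ N) ^ d)]
        ring
      · refine (degree_modByMonic_lt _ (hX.pow d)).trans_le ?_
        rw [← pow_mul, degree_X_pow]
  exact ⟨Q, hQ⟩

/-- Uniqueness of approximate roots over a domain. -/
lemma approximateRoot_unique [IsDomain R] {P Q Q' : R[X]} {N d : ℕ} (hd : ((d + 1 : ℕ) : R) ≠ 0)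
    (hQ : Q.Monic) (hQN : Q.natDegree = N) (hPQ : (P - Q ^ (d + 1)).degree < (N * d : ℕ))
    (hQ' : Q'.Monic) (hQN' : Q'.natDegree = N) (hPQ' : (P - Q' ^ (d + 1)).degree < (N * d : ℕ)) :
    Q = Q' := by
  by_contra hne
  have h1 : ((∑ i ∈ Finset.range (d + 1), Q ^ i * Q' ^ (d + 1 - 1 - i)) * (Q - Q')).degree
      < (N * d : ℕ) := by
    rw [(Commute.all Q Q').geom_sum₂_mul]
    have : Q ^ (d + 1) - Q' ^ (d + 1) = (P - Q' ^ (d + 1)) - (P - Q ^ (d + 1)) := by ring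
    rw [this]
    exact (degree_sub_le _ _).trans_lt (max_lt hPQ' hPQ)
  have h2 : (∑ i ∈ Finset.range (d + 1), Q ^ i * Q' ^ (d + 1 - 1 - i)).coeff (N * d)
      = (d + 1 : ℕ) := by
    rw [finsetSum_coeff]
    have h3 : ∀ i ∈ Finset.range (d + 1), (Q ^ i * Q' ^ (d + 1 - 1 - i)).coeff (N * d) = 1 := by
      intro i hi
      have hi := Finset.mem_range.1 hi
      have hm : (Q ^ i * Q' ^ (d + 1 - 1 - i)).Monic := (hQ.pow i).mul (hQ'.pow _)
      have hn : (Q ^ i * Q' ^ (d + 1 - 1 - i)).natDegree = N * d := by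
        rw [(hQ.pow i).natDegree_mul (hQ'.pow _), hQ.natDegree_pow, hQ'.natDegree_pow, hQN, hQN',
          ← add_mul, mul_comm]
        congr 1; omega
      rw [← hn]
      exact hm
    rw [Finset.sum_congr rfl h3]
    simp
  have h3 : ((N * d : ℕ) : WithBot ℕ) ≤
      (∑ i ∈ Finset.range (d + 1), Q ^ i * Q' ^ (d + 1 - 1 - i)).degree :=
    le_degree_of_ne_zero (by rw [h2]; exact hd)
  rw [degree_mul, degree_eq_natDegree (sub_ne_zero.2 hne)] at h1
  refine absurd (h3.trans_lt (lt_of_le_of_lt ?_ h1)) (lt_irrefl _)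
  exact le_add_of_nonneg_right (by exact_mod_cast Nat.zero_le _)

end ApproximateRoot

section Cyclic

open Lagrange

variable {E : Type*} [Field E] {v : AbsoluteValue E ℝ}

/-- If the polynomial with roots `y i` has approximate roots that are at least `1` in absolute value
at the `y i`, then its differences satisfy a lower product bound. -/
lemma one_le_prod_max (hv : IsNonarchimedean v) (hd : ∀ d : ℕ, d ≠ 0 → v d = 1) {n : ℕ} [NeZero n]
    (y : ZMod n → E) (φ : ZMod n → ℝ) (hφ : ∀ i j, v (y i - y j) = φ (i - j)) {b : ℝ} (hb : 0 < b)
    (hbmin : ∀ j ≠ 0, b ≤ φ j) (hbatt : ∃ j ≠ 0, φ j = b)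
    (hroot : ∀ d N : ℕ, N * (d + 1) = n → 0 < d → ∃ Q : E[X], Q.Monic ∧ Q.natDegree = N ∧
      (nodal Finset.univ y - Q ^ (d + 1)).degree < (N * d : ℕ) ∧ ∀ i, 1 ≤ v (Q.eval (y i))) :
    1 ≤ ∏ j, max b (φ j) := by
  classical
  have hφ' (i : ZMod n) : φ i = v (y i - y 0) := by rw [hφ, sub_zero]
  have hφ0 : φ 0 = 0 := by rw [hφ', sub_self, map_zero]
  have hφneg (i : ZMod n) : φ (-i) = φ i := by
    rw [hφ' i, ← zero_sub, ← hφ, v.map_sub]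
  have hφadd (i j : ZMod n) : φ (i + j) ≤ max (φ i) (φ j) := by
    have h1 : φ (i + j) = v ((y (i + j) - y j) + (y j - y 0)) := by rw [hφ']; congr 1; ring
    have h2 : φ i = v (y (i + j) - y j) := by rw [hφ, add_sub_cancel_right]
    rw [h1, h2, hφ' j]
    exact hv _ _
  let H : AddSubgroup (ZMod n) :=
    { carrier := {i | φ i ≤ b}
      zero_mem' := by rw [Set.mem_ofPred_eq, hφ0]; exact hb.le
      add_mem' := fun {i j} hi hj ↦ (hφadd i j).trans (max_le hi hj)
      neg_mem' := fun {i} hi ↦ by rw [Set.mem_ofPred_eq, hφneg]; exact hi }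
  have hH (i : ZMod n) : i ∈ H ↔ φ i ≤ b := Iff.rfl
  have hshift (i h : ZMod n) (hh : h ∈ H) : max b (φ (i + h)) = max b (φ i) := by
    have key (i h : ZMod n) (hh : h ∈ H) : max b (φ (i + h)) ≤ max b (φ i) :=
      max_le (le_max_left _ _) ((hφadd i h).trans
        (max_le (le_max_right _ _) (((hH h).1 hh).trans (le_max_left _ _))))
    refine le_antisymm (key i h hh) ?_
    have := key (i + h) (-h) (H.neg_mem hh)
    rwa [add_neg_cancel_right] at this
  let Ψ : ZMod n ⧸ H → ℝ := Quotient.lift (fun i ↦ max b (φ i)) fun i j hij ↦ by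
    have h1 : -i + j ∈ H := QuotientAddGroup.leftRel_apply.1 hij
    have h2 := hshift i _ h1
    rw [add_neg_cancel_left] at h2
    exact h2.symm
  have hΨ (i : ZMod n) : Ψ (i : ZMod n ⧸ H) = max b (φ i) := rfl
  have hout (c : ZMod n ⧸ H) : ((c.out : ZMod n) : ZMod n ⧸ H) = c := Quotient.out_eq' c
  let a : ZMod n ⧸ H → E := fun c ↦ y c.out
  have hdisc (c : ZMod n ⧸ H) (i : ZMod n) :
      discNorm v b (a c) (X - C (y i)) = Ψ (c - (i : ZMod n ⧸ H)) := by
    rw [discNorm_X_sub_C hb, hφ, ← hΨ, QuotientAddGroup.mk_sub, hout]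
  have ha (c c' : ZMod n ⧸ H) (hc : c ≠ c') : b ≤ v (a c - a c') := by
    rw [hφ]
    refine hbmin _ fun h ↦ hc ?_
    rw [← hout c, ← hout c', sub_eq_zero.1 h]
  set D := ∏ c, Ψ c with hD
  have hΨpos (c : ZMod n ⧸ H) : 0 < Ψ c := by
    rw [← hout c, hΨ]
    exact lt_max_of_lt_left hb
  have hDpos : 0 < D := Finset.prod_pos fun c _ ↦ hΨpos c
  have hF (c : ZMod n ⧸ H) : discNorm v b (a c) (nodal Finset.univ a) = D := by
    rw [nodal, discNorm_prod hv hb, hD, ← Equiv.prod_comp (Equiv.subLeft c) Ψ]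
    refine Finset.prod_congr rfl fun c' _ ↦ ?_
    rw [hdisc, hout]
    rfl
  have hP (c : ZMod n ⧸ H) : discNorm v b (a c) (nodal Finset.univ y) = ∏ j, max b (φ j) := by
    rw [nodal, discNorm_prod hv hb, ← Equiv.prod_comp (Equiv.subLeft c.out) fun j ↦ max b (φ j)]
    refine Finset.prod_congr rfl fun i _ ↦ ?_
    rw [hdisc, Equiv.subLeft_apply, ← hΨ, QuotientAddGroup.mk_sub, hout]
  obtain ⟨d, hdH⟩ : ∃ d, Nat.card H = d + 1 := ⟨Nat.card H - 1, by
    have := Nat.card_pos (α := H); omega⟩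
  have hdpos : 0 < d := by
    obtain ⟨j, hj0, hj⟩ := hbatt
    have : 1 < Nat.card H := by
      rw [AddSubgroup.one_lt_card_iff_ne_bot]
      intro h
      have h1 : j ∈ H := hj.le
      rw [h, AddSubgroup.mem_bot] at h1
      exact hj0 h1
    omega
  have hprod : ∏ j, max b (φ j) = D ^ (d + 1) := by
    have h1 : ∏ j : ZMod n, max b (φ j) = ∏ j : ZMod n, Ψ (j : ZMod n ⧸ H) := rfl
    rw [h1, Finset.prod_comp Ψ, hD, ← Finset.prod_pow,
      Finset.image_univ_of_surjective (QuotientAddGroup.mk_surjective)]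
    refine Finset.prod_congr rfl fun c _ ↦ ?_
    congr 1
    have h2 := Nat.card_congr (QuotientAddGroup.preimageMkEquivAddSubgroupProdSet H {c})
    rw [Nat.card_prod, Nat.card_unique (α := ({c} : Set (ZMod n ⧸ H))), mul_one, hdH] at h2
    rw [← h2, Nat.card_eq_fintype_card, Fintype.card_subtype]
    congr 1
    ext i
    simp
  have hn : Fintype.card (ZMod n ⧸ H) * (d + 1) = n := by
    rw [← hdH, ← Nat.card_eq_fintype_card, ← AddSubgroup.card_eq_card_quotient_mul_card_addSubgroup,
      Nat.card_zmod]
  set N := Fintype.card (ZMod n ⧸ H) with hN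
  have hPn : (nodal Finset.univ y).natDegree = N * (d + 1) := by
    rw [natDegree_nodal, Finset.card_univ, ZMod.card, hn]
  have hdE : v ((d + 1 : ℕ) : E) = 1 := hd _ d.succ_ne_zero
  have hdE0 : ((d + 1 : ℕ) : E) ≠ 0 := fun h ↦ by rw [h, map_zero] at hdE; exact zero_ne_one hdE
  obtain ⟨Q, hQ, hQN, hPQ, hQv⟩ := hroot d N hn hdpos
  obtain ⟨Q', hQb', hQ', hQN', hPQ'⟩ := exists_approximateRoot_of (d := d)
    (nodal_monic (s := Finset.univ) (v := a)) (by rw [natDegree_nodal, Finset.card_univ])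
    (nodal_monic (s := Finset.univ) (v := y)) hPn (isUnit_iff_ne_zero.2 hdE0)
    (fun q ↦ ∀ c, discNorm v b (a c) q ≤ D) (fun c ↦ (hF c).le) (by
      intro G hG _ _
      obtain ⟨q, r, h1, h2, h3⟩ := exists_quotient_nodal_pow hv hb hDpos ha hF d
        (A := nodal Finset.univ y - G ^ (d + 1)) (pow_nonneg hDpos.le (d + 1)) fun c ↦ by
          refine (discNorm_sub_le hv hb _ _ _).trans (max_le ?_ ?_)
          · rw [hP, hprod]
          · rw [discNorm_pow hv hb]
            exact pow_le_pow_left₀ (discNorm_nonneg hb _ _) (hG c) _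
      refine ⟨q, r, h1, by rwa [mul_comm], fun e he c ↦ ?_⟩
      refine (discNorm_add_le hv hb _ _ _).trans (max_le (hG c) ?_)
      have h4 := h3 c
      rw [← he, discNorm_mul hv hb, pow_succ, mul_div_cancel_left₀ _ (pow_pos hDpos _).ne'] at h4
      have h5 : (d + 1 : E[X]) = C ((d + 1 : ℕ) : E) := by simp
      rwa [h5, discNorm_C, hdE, one_mul] at h4)
  have hQQ : Q = Q' := approximateRoot_unique hdE0 hQ hQN hPQ hQ' hQN' hPQ'
  have h1 : 1 ≤ D := by
    refine (hQv (Quotient.out (0 : ZMod n ⧸ H))).trans ((eval_le_discNorm hb _ _).trans ?_)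
    rw [hQQ]
    exact hQb' 0
  rw [hprod]
  exact one_le_pow₀ h1

end Cyclic

section Parametrization

open Lagrange

variable {K E : Type*} [Field K] [Field E] [Algebra K E] {ι : Type*} [Fintype ι]

/-- The polynomial whose roots are the values of `y` at the roots of `x - t` is defined over the
coefficient ring `K[t]`. -/
lemma exists_map_eq_nodal (x y : K[X]) (z : ι → E) (t : E)
    (hx : x.map (algebraMap K E) = nodal Finset.univ z + C t) :
    ∃ P : K[X][X], P.map (aeval t : K[X] →ₐ[K] E).toRingHom
      = nodal Finset.univ fun i ↦ aeval (z i) y := by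
  set ψ : K[X] →+* E := (aeval t : K[X] →ₐ[K] E).toRingHom with hψ
  have hψC : ψ.comp C = algebraMap K E := by ext r; simp [hψ]
  set f : K[X][X][X] := x.map (C.comp C) - C (C X) with hf
  set g : K[X][X][X] := C X - y.map (C.comp C) with hg
  have hC (p : K[X]) : (p.map ((C : K[X] →+* K[X][X]).comp C)).map (mapRingHom ψ)
      = (p.map (algebraMap K E)).map C := by
    rw [map_map, map_map, ← hψC]
    congr 1
    ext r
    simp
  have hfm : f.map (mapRingHom ψ) = nodal Finset.univ fun i ↦ C (z i) := by
    rw [hf, Polynomial.map_sub, hC, hx, Polynomial.map_add, nodal, nodal, Polynomial.map_prod]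
    simp [hψ]
  have hgm : g.map (mapRingHom ψ) = C X - (y.map (algebraMap K E)).map C := by
    rw [hg, Polynomial.map_sub, hC]
    simp
  refine ⟨resultant f g (nodal Finset.univ fun i ↦ C (z i)).natDegree
    (g.map (mapRingHom ψ)).natDegree, ?_⟩
  rw [← coe_mapRingHom, ← resultant_map_map, hfm, resultant_eq_prod_eval _ _ _ le_rfl,
    nodal_monic.leadingCoeff, one_pow, one_mul]
  · have hroots : (nodal Finset.univ fun i ↦ C (z i)).roots
        = Finset.univ.val.map fun i ↦ C (z i) := by
      rw [nodal, Finset.prod]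
      simpa only [Multiset.map_map, Function.comp_def] using
        roots_multiset_prod_X_sub_C (Finset.univ.val.map fun i ↦ C (z i))
    rw [hroots, Multiset.map_map, nodal, Finset.prod, hgm]
    congr 1
    refine Multiset.map_congr rfl fun i _ ↦ ?_
    rw [Function.comp_apply, eval_sub, eval_C, eval_map, eval₂_at_apply, eval_map, aeval_def]
  · exact Splits.prod fun i _ ↦ Splits.X_sub_C _

/-- The value of `x'` at a point of the fibre is divisible by the different of the fibre. -/
lemma exists_aeval_derivative_eq_mul {x y : K[X]} {z : ι → E} {t : E}
    (hx : ∀ i, aeval (z i) x = t) (hy : Function.Injective fun i ↦ aeval (z i) y)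
    {P : K[X][X]} (hP : P.Monic)
    (hPmap : P.map (aeval t : K[X] →ₐ[K] E).toRingHom = nodal Finset.univ fun i ↦ aeval (z i) y)
    {g : K[X][X]} (hg : eval₂ (aeval x : K[X] →ₐ[K] K[X]).toRingHom y g = X) (i : ι) :
    ∃ r : K[X], aeval (z i) (derivative x)
      = eval (aeval (z i) y) (derivative (nodal Finset.univ fun i ↦ aeval (z i) y))
        * aeval (z i) r := by
  set ψ : K[X] →+* E := (aeval t : K[X] →ₐ[K] E).toRingHom with hψ
  have hev (j : ι) (q : K[X][X]) : eval (aeval (z j) y) (q.map ψ)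
      = aeval (z j) (eval₂ (aeval x : K[X] →ₐ[K] K[X]).toRingHom y q) := by
    rw [eval_map, ← AlgHom.coe_toRingHom (aeval (z j) : K[X] →ₐ[K] E), hom_eval₂]
    congr 1
    ext r <;> simp [hψ, hx]
  have hgz (j : ι) : eval (aeval (z j) y) (g.map ψ) = z j := by rw [hev, hg, aeval_X]
  set F := nodal Finset.univ fun i ↦ aeval (z i) y with hF
  have hdvd (A : K[X][X]) (hA : ∀ j, eval (aeval (z j) y) (A.map ψ) = 0) :
      A.map ψ = F * (A /ₘ P).map ψ := by
    have h1 : F ∣ A.map ψ := by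
      rw [hF, nodal]
      refine Finset.prod_dvd_of_coprime (fun j _ k _ hjk ↦ ?_) fun j _ ↦ dvd_iff_isRoot.2 (hA j)
      exact isCoprime_X_sub_C_of_isUnit_sub (sub_ne_zero.2 (hy.ne hjk)).isUnit
    rw [← hPmap, ← modByMonic_eq_zero_iff_dvd (hP.map ψ)] at h1
    conv_lhs => rw [← modByMonic_add_div (A.map ψ) (P.map ψ), h1, zero_add, hPmap]
    rw [map_divByMonic ψ hP, hPmap]
  have hψC : ψ.comp C = algebraMap K E := by ext r; simp [hψ]
  have hF0 : eval (aeval (z i) y) F = 0 :=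
    eval_nodal_at_node (v := fun i ↦ aeval (z i) y) (Finset.mem_univ i)
  have hder (A : K[X][X]) (hA : ∀ j, eval (aeval (z j) y) (A.map ψ) = 0) :
      ∃ u : K[X], eval (aeval (z i) y) (derivative (A.map ψ))
        = eval (aeval (z i) y) (derivative F) * aeval (z i) u := by
    refine ⟨eval₂ (aeval x : K[X] →ₐ[K] K[X]).toRingHom y (A /ₘ P), ?_⟩
    rw [hdvd A hA, derivative_mul, eval_add, eval_mul, eval_mul, hev, hF0, zero_mul,
      add_zero]
  have hcomp (p : K[X]) :
      (aeval g p).map ψ = (p.map (algebraMap K E)).comp (g.map ψ) := by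
    rw [← coe_mapRingHom, aeval_def, hom_eval₂, comp, eval₂_map, ← hψC]
    congr 1
    ext r
    simp
  have hcompev (p : K[X]) (j : ι) : eval (aeval (z j) y) ((aeval g p).map ψ) = aeval (z j) p := by
    rw [hcomp, eval_comp, hgz, eval_map, aeval_def]
  have hcompder (p : K[X]) : eval (aeval (z i) y) (derivative ((aeval g p).map ψ))
      = aeval (z i) (derivative p) * eval (aeval (z i) y) (derivative (g.map ψ)) := by
    rw [hcomp, derivative_comp, eval_mul, eval_comp, hgz, derivative_map p, mul_comm,
      eval_map_algebraMap]
  obtain ⟨u, hu⟩ := hder (aeval g x - C X) fun j ↦ by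
    rw [Polynomial.map_sub, eval_sub, hcompev, hx, map_C, eval_C]
    simp [hψ]
  obtain ⟨w, hw⟩ := hder (aeval g y - X) fun j ↦ by
    rw [Polynomial.map_sub, eval_sub, hcompev, map_X, eval_X, sub_self]
  rw [Polynomial.map_sub, derivative_sub, eval_sub, hcompder, map_C, derivative_C, eval_zero,
    sub_zero] at hu
  rw [Polynomial.map_sub, derivative_sub, eval_sub, hcompder, map_X, derivative_X, eval_one] at hw
  refine ⟨u * derivative y - w * derivative x, ?_⟩
  rw [map_sub, map_mul, map_mul]
  linear_combination aeval (z i) (derivative y) * hu - aeval (z i) (derivative x) * hw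

end Parametrization

section Estimate

open Lagrange

lemma lt_of_prod_estimate {n m : ℕ} [NeZero n] {φ : ZMod n → ℝ} {b : ℝ} (hb : 0 < b)
    (hφ0 : φ 0 = 0) (hφ : ∀ j ≠ 0, b ≤ φ j)
    (h1 : ∏ j ∈ Finset.univ.erase 0, φ j ≤ 2 ^ (n - 1)) (h2 : 1 ≤ ∏ j, max b (φ j))
    (hcard : 2 * (Finset.univ.filter fun j ↦ φ j ≠ 2 ^ m).card ≤ n) : m < n := by
  set S := Finset.univ.filter fun j ↦ φ j = 2 ^ m with hS
  set T := (Finset.univ.filter fun j ↦ φ j ≠ 2 ^ m).erase 0 with hT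
  have h0mem : (0 : ZMod n) ∈ Finset.univ.filter fun j ↦ φ j ≠ 2 ^ m := by
    simp only [Finset.mem_filter, Finset.mem_univ, true_and, hφ0]
    positivity
  have hTcard : (Finset.univ.filter fun j ↦ φ j ≠ 2 ^ m).card = T.card + 1 := by
    rw [hT, Finset.card_erase_add_one h0mem]
  have hScard : S.card + (T.card + 1) = n := by
    rw [← hTcard, hS, Finset.card_filter_add_card_filter_not, Finset.card_univ, ZMod.card]
  have hsplit : ∏ j ∈ Finset.univ.erase 0, φ j = (2 ^ m) ^ S.card * ∏ j ∈ T, φ j := by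
    have h3 : (Finset.univ.erase (0 : ZMod n)).filter (fun j ↦ φ j = 2 ^ m) = S := by
      ext j
      simp only [hS, Finset.mem_filter, Finset.mem_erase, Finset.mem_univ, and_true, true_and,
        and_iff_right_iff_imp]
      rintro hj rfl
      rw [hφ0] at hj
      exact absurd hj.symm (by positivity)
    have h4 : (Finset.univ.erase (0 : ZMod n)).filter (fun j ↦ ¬ φ j = 2 ^ m) = T := by
      rw [hT, Finset.filter_erase]
    rw [← Finset.prod_filter_mul_prod_filter_not _ (fun j ↦ φ j = 2 ^ m), h3, h4]
    congr 1
    exact Finset.prod_eq_pow_card fun j hj ↦ (Finset.mem_filter.1 hj).2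
  have hTprod : b ^ T.card ≤ ∏ j ∈ T, φ j :=
    (Finset.prod_const b (s := T)).symm.trans_le (Finset.prod_le_prod (fun _ _ ↦ hb.le) fun j hj ↦
      hφ j (Finset.ne_of_mem_erase hj))
  have h5 : ∏ j, max b (φ j) = b * ∏ j ∈ Finset.univ.erase 0, φ j := by
    rw [← Finset.mul_prod_erase _ _ (Finset.mem_univ 0), hφ0, max_eq_left hb.le]
    congr 1
    exact Finset.prod_congr rfl fun j hj ↦ max_eq_right (hφ j (Finset.ne_of_mem_erase hj))
  have h6 : 1 ≤ b * 2 ^ (n - 1) := by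
    rw [h5] at h2
    exact h2.trans (mul_le_mul_of_nonneg_left h1 hb.le)
  have h7 : (2 : ℝ) ^ (m * S.card) ≤ 2 ^ ((n - 1) * (T.card + 1)) := by
    calc (2 : ℝ) ^ (m * S.card) = (2 ^ m) ^ S.card * 1 := by rw [pow_mul, mul_one]
      _ ≤ (2 ^ m) ^ S.card * (b * 2 ^ (n - 1)) ^ T.card := by
        gcongr
        exact one_le_pow₀ h6
      _ = ((2 ^ m) ^ S.card * b ^ T.card) * (2 ^ (n - 1)) ^ T.card := by rw [mul_pow]; ring
      _ ≤ ((2 ^ m) ^ S.card * ∏ j ∈ T, φ j) * (2 ^ (n - 1)) ^ T.card := by gcongr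
      _ ≤ 2 ^ (n - 1) * (2 ^ (n - 1)) ^ T.card := by
        rw [← hsplit]; gcongr
      _ = 2 ^ ((n - 1) * (T.card + 1)) := by rw [pow_mul, pow_succ']
  have h8 : m * S.card ≤ (n - 1) * (T.card + 1) := (pow_le_pow_iff_right₀ one_lt_two).1 h7
  by_contra! hmn
  have hn : n ≠ 0 := NeZero.ne n
  have h9 : T.card + 1 ≤ S.card := by omega
  have h10 : n * (T.card + 1) ≤ m * S.card := Nat.mul_le_mul hmn h9
  have h11 : (n - 1) * (T.card + 1) < n * (T.card + 1) :=
    Nat.mul_lt_mul_of_pos_right (by omega) (by omega)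
  omega

variable {K E : Type*} [Field K] [CharZero K] [Field E] [Algebra K E] {v : AbsoluteValue E ℝ}

/-- The degree inequality deduced from the fibre `x = t` of a parametrization with a cyclic action. -/
lemma lt_of_fibre (hv : IsNonarchimedean v) (hd : ∀ d : ℕ, d ≠ 0 → v d = 1) {n m : ℕ} [NeZero n]
    {x y : K[X]} {z : ZMod n → E} {t : E} (hxn : x.natDegree = n)
    (hx : x.map (algebraMap K E) = nodal Finset.univ z + C t)
    (hz : ∀ i, ∀ p : K[X], p ≠ 0 → v (aeval (z i) p) = 2 ^ p.natDegree) {φ : ZMod n → ℝ}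
    (hφ : ∀ i j, v (aeval (z i) y - aeval (z j) y) = φ (i - j)) {g : K[X][X]}
    (hg : eval₂ (aeval x : K[X] →ₐ[K] K[X]).toRingHom y g = X)
    (hcard : 2 * (Finset.univ.filter fun j ↦ φ j ≠ 2 ^ m).card ≤ n) : m < n := by
  have hn : n ≠ 0 := NeZero.ne n
  have hzx (i : ZMod n) : aeval (z i) x = t := by
    have := congrArg (eval (z i)) hx
    rwa [eval_map_algebraMap, eval_add, eval_nodal_at_node (Finset.mem_univ i), zero_add, eval_C]
      at this
  have hz0 (i : ZMod n) (p : K[X]) (hp : p ≠ 0) : aeval (z i) p ≠ 0 := fun h ↦ by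
    have := hz i p hp
    rw [h, map_zero] at this
    exact absurd this.symm (by positivity)
  have hzone (i : ZMod n) (p : K[X]) (hp : p ≠ 0) : 1 ≤ v (aeval (z i) p) := by
    rw [hz i p hp]
    exact one_le_pow₀ one_le_two
  have hx'deg : (derivative x).natDegree = n - 1 := by rw [natDegree_derivative, hxn]
  have hx' : derivative x ≠ 0 := fun h ↦ by
    have := derivative_eq_zero.1 h
    omega
  have hzinj : Function.Injective z := by
    intro i j hij
    by_contra hne
    have h1 := congrArg (fun p ↦ eval (z i) (derivative p)) hx
    simp only [derivative_map, eval_map_algebraMap, derivative_add, derivative_C, add_zero] at h1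
    rw [eval_nodal_derivative_eval_node_eq (Finset.mem_univ i), eval_nodal] at h1
    exact hz0 i _ hx' (h1.trans (Finset.prod_eq_zero
      (Finset.mem_erase.2 ⟨Ne.symm hne, Finset.mem_univ j⟩) (sub_eq_zero.2 hij)))
  set ψ : K[X] →+* E := (aeval t : K[X] →ₐ[K] E).toRingHom with hψ
  have hev (j : ZMod n) (q : K[X][X]) : eval (aeval (z j) y) (q.map ψ)
      = aeval (z j) (eval₂ (aeval x : K[X] →ₐ[K] K[X]).toRingHom y q) := by
    rw [eval_map, ← AlgHom.coe_toRingHom (aeval (z j) : K[X] →ₐ[K] E), hom_eval₂]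
    congr 1
    ext r <;> simp [hψ, hzx]
  have hyinj : Function.Injective fun i ↦ aeval (z i) y := fun i j hij ↦ by
    have h1 := hev i g
    have h2 := hev j g
    rw [hg, aeval_X] at h1 h2
    simp only at hij
    exact hzinj (by rw [← h1, ← h2, hij])
  obtain ⟨P, hP⟩ := exists_map_eq_nodal x y z t hx
  have hψinj : Function.Injective ψ := by
    rw [injective_iff_map_eq_zero]
    intro p hp
    by_contra hp0
    have h1 : ψ p = aeval (z 0) (p.comp x) := by
      rw [← hzx 0] at hψ
      rw [hψ, aeval_comp]
      rfl
    rw [h1] at hp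
    refine hz0 0 _ (fun h ↦ ?_) hp
    rcases comp_eq_zero_iff.1 h with h | h
    · exact hp0 h
    · have := congrArg natDegree h.2
      rw [natDegree_C] at this
      omega
  have hPm : P.Monic := monic_of_injective hψinj (by rw [hP]; exact nodal_monic)
  have hφ0 : φ 0 = 0 := by rw [← sub_self (0 : ZMod n), ← hφ, sub_self, map_zero]
  have hφpos (j : ZMod n) (hj : j ≠ 0) : 0 < φ j := by
    rw [← sub_zero j, ← hφ]
    exact v.pos (sub_ne_zero.2 (hyinj.ne hj))
  have h0mem : (0 : ZMod n) ∈ Finset.univ.filter fun j ↦ φ j ≠ 2 ^ m := by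
    simp only [Finset.mem_filter, Finset.mem_univ, true_and, hφ0]
    positivity
  have hn2 : 2 ≤ n := by
    have := Finset.card_pos.2 ⟨_, h0mem⟩
    omega
  have : Fact (1 < n) := ⟨hn2⟩
  obtain ⟨j₀, hj₀, hmin⟩ := Finset.exists_min_image (Finset.univ.erase (0 : ZMod n)) φ
    ⟨1, Finset.mem_erase.2 ⟨one_ne_zero, Finset.mem_univ _⟩⟩
  have hj₀0 := Finset.ne_of_mem_erase hj₀
  have hmin' (j : ZMod n) (hj : j ≠ 0) : φ j₀ ≤ φ j :=
    hmin j (Finset.mem_erase.2 ⟨hj, Finset.mem_univ _⟩)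
  refine lt_of_prod_estimate (hφpos j₀ hj₀0) hφ0 hmin' ?_ ?_ hcard
  · obtain ⟨r, hr⟩ := exists_aeval_derivative_eq_mul hzx hyinj hPm hP hg 0
    have hr0 : r ≠ 0 := fun h ↦ hz0 0 _ hx' (by rw [hr, h, map_zero, mul_zero])
    have h1 := congrArg v hr
    rw [hz _ _ hx', hx'deg, map_mul,
      eval_nodal_derivative_eval_node_eq (v := fun i ↦ aeval (z i) y) (Finset.mem_univ 0),
      eval_nodal, map_prod] at h1
    have h2 : ∏ j ∈ Finset.univ.erase 0, v (aeval (z 0) y - aeval (z j) y)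
        = ∏ j ∈ Finset.univ.erase 0, φ j :=
      Finset.prod_congr rfl fun j _ ↦ by rw [v.map_sub, hφ, sub_zero]
    rw [h2] at h1
    rw [h1]
    exact le_mul_of_one_le_right
      (Finset.prod_nonneg fun j hj ↦ (hφpos j (Finset.ne_of_mem_erase hj)).le) (hzone 0 r hr0)
  · refine one_le_prod_max hv hd (fun i ↦ aeval (z i) y) φ hφ (hφpos j₀ hj₀0) hmin'
      ⟨j₀, hj₀0, rfl⟩ fun d N hN hd0 ↦ ?_
    have hPn : P.natDegree = N * (d + 1) := by
      rw [← natDegree_map_eq_of_injective hψinj, hP, natDegree_nodal, Finset.card_univ, ZMod.card,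
        hN]
    have hdu : IsUnit ((d + 1 : ℕ) : K[X]) := by
      have : IsUnit ((d + 1 : ℕ) : K) := (Nat.cast_ne_zero.2 d.succ_ne_zero).isUnit
      simpa using this.map C
    obtain ⟨Q, hQ, hQN, hPQ⟩ := exists_approximateRoot hPm hPn hdu
    refine ⟨Q.map ψ, hQ.map ψ, ?_, ?_, fun i ↦ ?_⟩
    · rw [hQ.natDegree_map, hQN]
    · rw [← hP, ← Polynomial.map_pow, ← Polynomial.map_sub]
      exact (degree_map_le).trans_lt hPQ
    · rw [hev]
      refine hzone i _ fun h ↦ ?_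
      have h1 : (Q.map ψ) = 0 := by
        refine eq_zero_of_natDegree_lt_card_of_eval_eq_zero _ hyinj (fun j ↦ ?_) ?_
        · rw [hev, h, map_zero]
        · rw [hQ.natDegree_map, hQN, ZMod.card, ← hN]
          have : 0 < N := Nat.pos_of_ne_zero fun h ↦ by rw [h, zero_mul] at hN; exact hn hN.symm
          nlinarith
      exact (hQ.map ψ).ne_zero h1

end Estimate

section Laurent

/-- The endomorphism `s ↦ c s` of the field of formal Laurent series in `s`. -/
noncomputable def laurentRescale (c : ℂˣ) : HahnSeries ℤ ℂ →ₐ[ℂ] HahnSeries ℤ ℂ :=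
  have hsupp (f : HahnSeries ℤ ℂ) :
      (Function.support fun n : ℤ ↦ ((c ^ n : ℂˣ) : ℂ) * f.coeff n) = f.support := by
    ext n
    simp [zpow_ne_zero]
  { toFun f := ⟨fun n ↦ ((c ^ n : ℂˣ) : ℂ) * f.coeff n, by rw [hsupp]; exact f.isPWO_support⟩
    map_add' f g := by ext n; simp [mul_add]
    map_zero' := by ext n; simp
    map_one' := by
      ext n
      by_cases hn : n = 0
      · simp [hn]
      · simp [HahnSeries.coeff_one, hn]
    commutes' a := by
      ext n
      rw [LaurentSeries.algebraMap_apply]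
      by_cases hn : n = 0
      · simp [hn]
      · simp [HahnSeries.coeff_single_of_ne hn]
    map_mul' f g := by
      ext n
      simp only [HahnSeries.coeff_mul, Finset.mul_sum]
      refine Finset.sum_congr ?_ fun ij hij ↦ ?_
      · ext ij
        simp [HahnSeries.mem_support, zpow_ne_zero]
      · rw [Finset.mem_antidiagonal] at hij
        rw [← hij.2.2, zpow_add, Units.val_mul]
        ring }

@[simp]
lemma coeff_laurentRescale (c : ℂˣ) (f : HahnSeries ℤ ℂ) (n : ℤ) :
    (laurentRescale c f).coeff n = ((c ^ n : ℂˣ) : ℂ) * f.coeff n := rfl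

lemma laurentRescale_mul (c d : ℂˣ) (f : HahnSeries ℤ ℂ) :
    laurentRescale (c * d) f = laurentRescale c (laurentRescale d f) := by
  ext n
  simp [mul_zpow, mul_assoc]

open Classical in
/-- The `s`-adic absolute value on formal Laurent series in `s`, normalised by `|s| = 1/2`. -/
noncomputable def laurentAbs : AbsoluteValue (HahnSeries ℤ ℂ) ℝ where
  toFun f := if f = 0 then 0 else 2 ^ (-f.order)
  map_mul' f g := by
    by_cases hf : f = 0
    · simp [hf]
    by_cases hg : g = 0
    · simp [hg]
    rw [if_neg hf, if_neg hg, if_neg (mul_ne_zero hf hg), HahnSeries.order_mul hf hg, neg_add,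
      zpow_add₀ two_ne_zero]
  nonneg' f := by positivity
  eq_zero' f := by
    by_cases hf : f = 0
    · simp [hf]
    · simp [hf, zpow_ne_zero]
  add_le' f g := by
    by_cases hf : f = 0
    · simp [hf]
    by_cases hg : g = 0
    · simp [hg]
    by_cases h : f + g = 0
    · rw [if_pos h]
      positivity
    rw [if_neg hf, if_neg hg, if_neg h]
    have h1 := HahnSeries.min_order_le_order_add h
    have hpf : (0 : ℝ) < 2 ^ (-f.order) := by positivity
    have hpg : (0 : ℝ) < 2 ^ (-g.order) := by positivity
    rcases min_le_iff.1 h1 with h1 | h1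
    · exact (zpow_le_zpow_right₀ one_le_two (neg_le_neg h1)).trans (by linarith)
    · exact (zpow_le_zpow_right₀ one_le_two (neg_le_neg h1)).trans (by linarith)

lemma laurentAbs_of_ne_zero {f : HahnSeries ℤ ℂ} (hf : f ≠ 0) :
    laurentAbs f = 2 ^ (-f.order) := if_neg hf

lemma isNonarchimedean_laurentAbs : IsNonarchimedean laurentAbs := fun f g ↦ by
  by_cases hf : f = 0
  · simp [hf]
  by_cases hg : g = 0
  · simp [hg]
  by_cases h : f + g = 0
  · simp [h]
  rw [laurentAbs_of_ne_zero hf, laurentAbs_of_ne_zero hg, laurentAbs_of_ne_zero h]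
  have h1 := HahnSeries.min_order_le_order_add h
  rw [le_max_iff]
  exact (min_le_iff.1 h1).imp (fun h ↦ zpow_le_zpow_right₀ one_le_two (neg_le_neg h))
    fun h ↦ zpow_le_zpow_right₀ one_le_two (neg_le_neg h)

lemma laurentAbs_eq {f : HahnSeries ℤ ℂ} {k : ℤ} (hk : f.coeff k ≠ 0)
    (hlt : ∀ j < k, f.coeff j = 0) : laurentAbs f = 2 ^ (-k) := by
  have hf : f ≠ 0 := fun h ↦ hk (by simp [h])
  rw [laurentAbs_of_ne_zero hf]
  congr 2
  refine le_antisymm (HahnSeries.order_le_of_coeff_ne_zero hk) ?_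
  rw [HahnSeries.le_order_iff_forall hf]
  exact hlt

lemma laurentAbs_algebraMap {c : ℂ} (hc : c ≠ 0) :
    laurentAbs (algebraMap ℂ (HahnSeries ℤ ℂ) c) = 1 := by
  rw [LaurentSeries.algebraMap_apply, laurentAbs_of_ne_zero (by simpa using hc), HahnSeries.order_C]
  simp

lemma laurentAbs_laurentRescale (c : ℂˣ) (f : HahnSeries ℤ ℂ) :
    laurentAbs (laurentRescale c f) = laurentAbs f := by
  by_cases hf : f = 0
  · simp [hf]
  rw [laurentAbs_of_ne_zero hf]
  refine laurentAbs_eq ?_ fun j hj ↦ ?_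
  · simpa [zpow_ne_zero] using hf
  · simp [HahnSeries.coeff_eq_zero_of_lt_order hj]

lemma laurentAbs_laurentRescale_sub {c : ℂˣ} {f : HahnSeries ℤ ℂ} {m : ℕ}
    (hf : laurentAbs f = 2 ^ m) (hc : c ^ m ≠ 1) :
    laurentAbs (laurentRescale c f - f) = 2 ^ m := by
  have hf0 : f ≠ 0 := by
    rintro rfl
    rw [map_zero] at hf
    exact (pow_ne_zero m two_ne_zero) hf.symm
  have ho : f.order = -m := by
    rw [laurentAbs_of_ne_zero hf0, ← zpow_natCast] at hf
    have := zpow_right_injective₀ two_pos (by norm_num) hf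
    omega
  have := laurentAbs_eq (f := laurentRescale c f - f) (k := -m) ?_ ?_
  · rw [this, neg_neg, zpow_natCast]
  · rw [HahnSeries.coeff_sub, coeff_laurentRescale, ← sub_one_mul]
    refine mul_ne_zero (sub_ne_zero.2 fun h ↦ hc ?_) ?_
    · rw [← Units.val_one, Units.val_inj, zpow_neg, inv_eq_one, zpow_natCast] at h
      exact h
    · rw [← ho]
      simpa using hf0
  · intro j hj
    rw [HahnSeries.coeff_sub, coeff_laurentRescale,
      HahnSeries.coeff_eq_zero_of_lt_order (hj.trans_eq ho.symm)]
    simp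

lemma laurentAbs_aeval {z : HahnSeries ℤ ℂ} (hz : laurentAbs z = 2) (p : ℂ[X]) (hp : p ≠ 0) :
    laurentAbs (aeval z p) = 2 ^ p.natDegree := by
  induction hd : p.natDegree generalizing p with
  | zero =>
    obtain ⟨c, rfl⟩ := natDegree_eq_zero.1 hd
    rw [aeval_C, pow_zero, laurentAbs_algebraMap (fun h ↦ hp (by rw [h, C_0]))]
  | succ d ih =>
    have hq : p.divX.natDegree = d := by rw [natDegree_divX_eq_natDegree_tsub_one, hd]; rfl
    have hq0 : p.divX ≠ 0 := fun h ↦ by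
      rw [divX_eq_zero_iff] at h
      rw [h, natDegree_C] at hd
      omega
    have h1 : laurentAbs (aeval z (p.divX * X)) = 2 ^ (d + 1) := by
      rw [map_mul, aeval_X, map_mul, ih _ hq0 hq, hz, pow_succ]
    have h2 : laurentAbs (aeval z (C (p.coeff 0))) < 2 ^ (d + 1) := by
      rw [aeval_C]
      by_cases hc : p.coeff 0 = 0
      · rw [hc, map_zero, map_zero]
        positivity
      · rw [laurentAbs_algebraMap hc]
        exact one_lt_pow₀ one_lt_two d.succ_ne_zero
    conv_lhs => rw [← divX_mul_X_add p, map_add]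
    rw [isNonarchimedean_laurentAbs.add_eq_max_of_ne (by rw [h1]; exact h2.ne'), h1,
      max_eq_left h2.le]

open PowerSeries in
/-- A Laurent series solving `x(z) = s⁻ⁿ`, obtained from the lemma of Hensel. -/
lemma exists_laurent_root {x : ℂ[X]} (hx : x.Monic) (hn : x.natDegree ≠ 0) :
    ∃ z : HahnSeries ℤ ℂ, laurentAbs z = 2 ∧
      aeval z x = HahnSeries.single (-(x.natDegree : ℤ)) 1 := by
  set n := x.natDegree with hn'
  set p : (PowerSeries ℂ)[X] := x.map (PowerSeries.C (R := ℂ)) with hp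
  have hpm : p.Monic := hx.map _
  have hpn : p.natDegree = n := hx.natDegree_map _
  set F : (PowerSeries ℂ)[X] := p.scaleRoots PowerSeries.X - C 1 with hF
  have hsm : (p.scaleRoots PowerSeries.X).Monic := (monic_scaleRoots_iff _).2 hpm
  have hFm : F.Monic := by
    refine hsm.sub_of_left ?_
    rw [degree_scaleRoots, degree_eq_natDegree hpm.ne_zero, hpn]
    refine degree_C_le.trans_lt ?_
    exact_mod_cast Nat.pos_of_ne_zero hn
  have hFmap : F.map (PowerSeries.constantCoeff (R := ℂ)) = X ^ n - C 1 := by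
    rw [hF, Polynomial.map_sub, map_scaleRoots _ _ _ (by rw [hpm.leadingCoeff]; simp), hp, map_map]
    have : (PowerSeries.constantCoeff (R := ℂ)).comp PowerSeries.C = RingHom.id ℂ := by ext; simp
    rw [this, Polynomial.map_id]
    simp [scaleRoots_zero, hx.leadingCoeff, hn']
  have hmem (a : PowerSeries ℂ) :
      a ∈ Ideal.span {(PowerSeries.X : PowerSeries ℂ)} ↔ PowerSeries.constantCoeff a = 0 := by
    rw [Ideal.mem_span_singleton, PowerSeries.X_dvd_iff]
  obtain ⟨u, hu, hu1⟩ := HenselianRing.is_henselian (I := Ideal.span {(PowerSeries.X : PowerSeries ℂ)})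
    F hFm 1 (by
      rw [hmem, ← eval_map_apply, hFmap]
      simp) (by
      refine IsUnit.map _ (PowerSeries.isUnit_iff_constantCoeff.2 ?_)
      rw [← eval_map_apply, ← derivative_map, hFmap]
      simpa [derivative_X_pow] using hn)
  rw [hmem] at hu1
  have hu0 : PowerSeries.constantCoeff u = 1 := by
    rw [map_sub, map_one, sub_eq_zero] at hu1
    exact hu1
  set ι := HahnSeries.ofPowerSeries ℤ ℂ with hι
  have hιX : ι PowerSeries.X = HahnSeries.single 1 1 := by simp [hι]
  set z : HahnSeries ℤ ℂ := HahnSeries.single (-1) 1 * ι u with hz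
  have hsz : ι PowerSeries.X * z = ι u := by
    rw [hιX, hz, ← mul_assoc, HahnSeries.single_mul_single]
    simp
  have hιu : laurentAbs (ι u) = 1 := by
    rw [laurentAbs_eq (k := 0)]
    · simp
    · have := LaurentSeries.coeff_coe_powerSeries u 0
      rw [Nat.cast_zero] at this
      rw [this]
      simp [hu0]
    · intro j hj
      rw [hι, HahnSeries.ofPowerSeries_apply]
      apply HahnSeries.embDomain_of_notMem_range
      rintro ⟨k, hk⟩
      simp at hk
      omega
  refine ⟨z, ?_, ?_⟩
  · rw [hz, map_mul, hιu, mul_one, laurentAbs_eq (k := -1)]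
    · simp
    · simp
    · intro j hj
      exact HahnSeries.coeff_single_of_ne hj.ne
  · have h1 := scaleRoots_eval₂_mul (p := p) ι z PowerSeries.X
    rw [hsz, hpn, hp, eval₂_map] at h1
    have h2 : eval₂ ι (ι u) (p.scaleRoots PowerSeries.X) = 1 := by
      rw [eval₂_at_apply]
      have : eval u (p.scaleRoots PowerSeries.X) = 1 := by
        have := hu
        rw [IsRoot.def, hF, eval_sub, eval_C, sub_eq_zero] at this
        exact this
      rw [this, map_one]
    have h3 : ι.comp (PowerSeries.C (R := ℂ)) = algebraMap ℂ (HahnSeries ℤ ℂ) := by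
      ext a : 1
      rw [RingHom.comp_apply, hι, HahnSeries.ofPowerSeries_C, LaurentSeries.algebraMap_apply]
    rw [← hp, h2, h3, hιX, HahnSeries.single_pow, one_pow, ← aeval_def] at h1
    have h4 : (HahnSeries.single (-(n : ℤ)) (1 : ℂ)) * HahnSeries.single (n • (1 : ℤ)) 1 = 1 := by
      rw [HahnSeries.single_mul_single]
      simp
    rw [← one_mul (aeval z x), ← h4, mul_assoc, ← h1, mul_one]

lemma laurentRescale_single {c : ℂˣ} {n : ℤ} (hc : c ^ n = 1) :
    laurentRescale c (HahnSeries.single n 1) = HahnSeries.single n 1 := by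
  ext j
  rw [coeff_laurentRescale]
  by_cases hj : j = n
  · simp [hj, hc]
  · simp [HahnSeries.coeff_single_of_ne hj]

open Classical in
lemma laurent_card_filter_le {n m : ℕ} [NeZero n] (hnm : ¬ n ∣ m) {e : ZMod n → ℂˣ}
    (he : ∀ i j, e (i + j) = e i * e j) (hinj : Function.Injective e) :
    2 * (Finset.univ.filter fun j ↦ e j ^ m = 1).card ≤ n := by
  have he0 : e 0 = 1 := by simpa using he 0 0
  have hpow (j : ZMod n) (k : ℕ) : e j ^ k = e (k * j) := by
    induction k with
    | zero => simp [he0]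
    | succ k ih => rw [pow_succ, ih, ← he, Nat.cast_succ, add_one_mul]
  set H : AddSubgroup (ZMod n) := (AddMonoidHom.mulLeft (m : ZMod n)).ker with hH
  have hmem (j : ZMod n) : j ∈ H ↔ e j ^ m = 1 := by
    rw [hH, AddMonoidHom.mem_ker, AddMonoidHom.coe_mulLeft, hpow, ← he0, hinj.eq_iff]
  have hcard : (Finset.univ.filter fun j ↦ e j ^ m = 1).card = Nat.card H := by
    rw [← Finset.filter_congr fun j _ ↦ hmem j, Nat.card_eq_fintype_card, Fintype.card_subtype]
  have hi : H.index ≠ 1 := fun h ↦ by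
    rw [AddSubgroup.index_eq_one] at h
    have h1 : (1 : ZMod n) ∈ H := by rw [h]; trivial
    rw [hH, AddMonoidHom.mem_ker, AddMonoidHom.coe_mulLeft, mul_one,
      ZMod.natCast_eq_zero_iff] at h1
    exact hnm h1
  have hi0 : H.index ≠ 0 := AddSubgroup.index_ne_zero_of_finite
  have h2 := H.card_mul_index
  rw [Nat.card_eq_fintype_card (α := ZMod n), ZMod.card] at h2
  rw [hcard, mul_comm]
  calc Nat.card H * 2 ≤ Nat.card H * H.index := Nat.mul_le_mul_left _ (by omega)
    _ = n := h2

/-- If `ℂ[x, y] = ℂ[X]` with `x` monic and `deg x ∤ deg y`, then `deg y < deg x`. -/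
lemma natDegree_lt_of_not_dvd {x y : ℂ[X]} (hx : x.Monic) (hn : x.natDegree ≠ 0)
    (hnm : ¬ x.natDegree ∣ y.natDegree) {g : ℂ[X][X]}
    (hg : eval₂ (aeval x : ℂ[X] →ₐ[ℂ] ℂ[X]).toRingHom y g = X) :
    y.natDegree < x.natDegree := by
  classical
  obtain ⟨z₀, hz₀, hxz₀⟩ := exists_laurent_root hx hn
  obtain ⟨n, hn'⟩ : ∃ n, n = x.natDegree := ⟨_, rfl⟩
  rw [← hn'] at hn hnm hxz₀ ⊢
  have : NeZero n := ⟨hn⟩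
  have hy : y ≠ 0 := by
    rintro rfl
    exact hnm (by simp)
  set m := y.natDegree with hm
  set e : ZMod n → ℂˣ := fun i ↦ (ZMod.stdAddChar (N := n)).toMonoidHom.toHomUnits
    (Multiplicative.ofAdd i) with he
  have hecoe (i : ZMod n) : ((e i : ℂˣ) : ℂ) = ZMod.stdAddChar i := rfl
  have hadd (i j : ZMod n) : e (i + j) = e i * e j := by
    ext
    rw [Units.val_mul, hecoe, hecoe, hecoe, AddChar.map_add_eq_mul]
  have hinj : Function.Injective e := fun i j h ↦
    ZMod.injective_stdAddChar (by rw [← hecoe, ← hecoe, h])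
  have he0 : e 0 = 1 := by simpa using hadd 0 0
  have hpow (j : ZMod n) (k : ℕ) : e j ^ k = e (k * j) := by
    induction k with
    | zero => simp [he0]
    | succ k ih => rw [pow_succ, ih, ← hadd, Nat.cast_succ, add_one_mul]
  have hen (i : ZMod n) : e i ^ n = 1 := by rw [hpow]; simp [he0]
  set z : ZMod n → HahnSeries ℤ ℂ := fun i ↦ laurentRescale (e i) z₀ with hzdef
  have hzp (i : ZMod n) (p : ℂ[X]) : aeval (z i) p = laurentRescale (e i) (aeval z₀ p) :=
    aeval_algHom_apply _ _ _
  have hxz (i : ZMod n) : aeval (z i) x = HahnSeries.single (-(n : ℤ)) 1 := by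
    rw [hzp, hxz₀, laurentRescale_single]
    rw [zpow_neg, zpow_natCast, hen, inv_one]
  have hzv (i : ZMod n) : laurentAbs (z i) = 2 := by rw [hzdef, laurentAbs_laurentRescale, hz₀]
  have hsub (i j : ZMod n) (f : HahnSeries ℤ ℂ) :
      laurentAbs (laurentRescale (e i) f - laurentRescale (e j) f) =
        laurentAbs (laurentRescale (e (i - j)) f - f) := by
    have : e i = e j * e (i - j) := by rw [← hadd, add_sub_cancel]
    rw [this, laurentRescale_mul, ← map_sub, laurentAbs_laurentRescale]
  have hzinj : Function.Injective z := fun i j hij ↦ by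
    by_contra hne
    have h1 := hsub i j z₀
    rw [laurentAbs_laurentRescale_sub (m := 1) (by rw [hz₀, pow_one])] at h1
    · rw [show laurentRescale (e i) z₀ = laurentRescale (e j) z₀ from hij, sub_self,
        map_zero] at h1
      norm_num at h1
    · rw [pow_one, ← he0]
      exact fun h ↦ hne (sub_eq_zero.1 (hinj h))
  have hxmap : x.map (algebraMap ℂ (HahnSeries ℤ ℂ)) =
      Lagrange.nodal Finset.univ z + C (HahnSeries.single (-(n : ℤ)) 1) := by
    rw [← sub_eq_zero]
    refine eq_zero_of_degree_lt_of_eval_finset_eq_zero (Finset.univ.image z) ?_ ?_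
    · rw [Finset.card_image_of_injective _ hzinj, Finset.card_univ, ZMod.card]
      have hd : (x.map (algebraMap ℂ (HahnSeries ℤ ℂ))).degree = n := by
        rw [hx.degree_map, degree_eq_natDegree hx.ne_zero, hn']
      have hnod : (Lagrange.nodal Finset.univ z +
          C (HahnSeries.single (-(n : ℤ)) (1 : ℂ))).Monic ∧
          (Lagrange.nodal Finset.univ z +
          C (HahnSeries.single (-(n : ℤ)) (1 : ℂ))).degree = n := by
        have h1 : (Lagrange.nodal Finset.univ z).degree = n := by
          rw [Lagrange.degree_nodal, Finset.card_univ, ZMod.card]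
        have h2 : (C (HahnSeries.single (-(n : ℤ)) (1 : ℂ))).degree <
            (Lagrange.nodal Finset.univ z).degree := by
          rw [h1]
          refine degree_C_le.trans_lt ?_
          exact_mod_cast Nat.pos_of_ne_zero hn
        exact ⟨Lagrange.nodal_monic.add_of_left h2, by rw [degree_add_eq_left_of_degree_lt h2, h1]⟩
      rw [← hd]
      refine degree_sub_lt_left (by rw [hd, hnod.2]) (hx.map _).ne_zero ?_
      rw [(hx.map _).leadingCoeff, hnod.1.leadingCoeff]
    · intro w hw
      obtain ⟨i, -, rfl⟩ := Finset.mem_image.1 hw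
      rw [eval_sub, eval_map_algebraMap, hxz, eval_add, eval_C,
        Lagrange.eval_nodal_at_node (Finset.mem_univ i), zero_add, sub_self]
  have hyv : laurentAbs (aeval z₀ y) = 2 ^ m := laurentAbs_aeval hz₀ y hy
  refine lt_of_fibre isNonarchimedean_laurentAbs (fun d hd ↦ ?_) hn'.symm hxmap
    (fun i p hp ↦ laurentAbs_aeval (hzv i) p hp)
    (φ := fun k ↦ laurentAbs (laurentRescale (e k) (aeval z₀ y) - aeval z₀ y))
    (fun i j ↦ ?_) hg ?_
  · have := laurentAbs_algebraMap (c := d) (by exact_mod_cast hd)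
    rwa [map_natCast] at this
  · rw [hzp, hzp, hsub]
  · refine le_trans (Nat.mul_le_mul_left 2 (Finset.card_le_card fun j hj ↦ ?_))
      (laurent_card_filter_le hnm hadd hinj)
    rw [Finset.mem_filter] at hj ⊢
    refine ⟨hj.1, ?_⟩
    by_contra h
    exact hj.2 (laurentAbs_laurentRescale_sub hyv h)

end Laurent

/-- If `ℂ[x, y] = ℂ[X]` and `deg x ≤ deg y`, then `deg x ∣ deg y`. -/
lemma natDegree_dvd_natDegree_of_surjective {φ : MvPolynomial (Fin 2) ℂ →ₐ[ℂ] ℂ[X]}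
    (hφ : Function.Surjective φ) (h0 : (φ (.X 0)).natDegree ≠ 0)
    (hle : (φ (.X 0)).natDegree ≤ (φ (.X 1)).natDegree) :
    (φ (.X 0)).natDegree ∣ (φ (.X 1)).natDegree := by
  by_contra hnd
  obtain ⟨p, hp⟩ := hφ X
  set x := φ (.X 0) with hx
  set y := φ (.X 1) with hy
  have hx0 : x ≠ 0 := fun h ↦ h0 (by rw [h, natDegree_zero])
  have ha : x.leadingCoeff ≠ 0 := leadingCoeff_ne_zero.2 hx0
  set x' := x * C x.leadingCoeff⁻¹ with hx'
  have hx'm : x'.Monic := monic_mul_leadingCoeff_inv hx0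
  have hx'n : x'.natDegree = x.natDegree := natDegree_mul_leadingCoeff_inv _ hx0
  have hxx' : C x.leadingCoeff * x' = x := by
    rw [hx', mul_left_comm, ← C_mul, mul_inv_cancel₀ ha, C_1, mul_one]
  have hg (p : MvPolynomial (Fin 2) ℂ) : eval₂ (aeval x' : ℂ[X] →ₐ[ℂ] ℂ[X]).toRingHom y
      (MvPolynomial.aeval ![C (C x.leadingCoeff * X), (X : ℂ[X][X])] p) = φ p := by
    induction p using MvPolynomial.induction_on with
    | C a =>
      rw [MvPolynomial.algHom_C, MvPolynomial.algHom_C, IsScalarTower.algebraMap_apply ℂ ℂ[X] ℂ[X][X],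
        algebraMap_eq, eval₂_C]
      simp
    | add p q hp hq => rw [map_add, map_add, eval₂_add, hp, hq]
    | mul_X p i hp =>
      rw [map_mul φ, map_mul (MvPolynomial.aeval _), eval₂_mul, hp]
      congr 1
      fin_cases i
      · simpa using hxx'
      · simp [hy]
  have := natDegree_lt_of_not_dvd hx'm (by rwa [hx'n]) (by rwa [hx'n]) ((hg p).trans hp)
  omega

end Polynomial

namespace MvPolynomial

/-- The elementary automorphism `(X₀, X₁) ↦ (X₀, X₁ + q(X₀))`. -/
lemma exists_shear {R : Type*} [CommRing R] (q : Polynomial R) :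
    ∃ τ : MvPolynomial (Fin 2) R ≃ₐ[R] MvPolynomial (Fin 2) R,
      τ (X 0) = X 0 ∧ τ (X 1) = X 1 + Polynomial.aeval (X 0) q := by
  refine ⟨AlgEquiv.ofAlgHom (aeval ![X 0, X 1 + Polynomial.aeval (X 0) q])
    (aeval ![X 0, X 1 - Polynomial.aeval (X 0) q]) ?_ ?_, by simp, by simp⟩
  · refine algHom_ext fun i ↦ ?_
    fin_cases i <;> simp [← Polynomial.aeval_algHom_apply]
  · refine algHom_ext fun i ↦ ?_
    fin_cases i <;> simp [← Polynomial.aeval_algHom_apply]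

lemma exists_scale {R : Type*} [CommRing R] (u : Rˣ) :
    ∃ τ : MvPolynomial (Fin 2) R ≃ₐ[R] MvPolynomial (Fin 2) R, τ (X 0) = C (u : R) * X 0 := by
  refine ⟨AlgEquiv.ofAlgHom (aeval ![C (u : R) * X 0, X 1])
    (aeval ![C ((u⁻¹ : Rˣ) : R) * X 0, X 1]) ?_ ?_, by simp⟩
  · refine algHom_ext fun i ↦ ?_
    fin_cases i
    · simp [← mul_assoc, ← C_mul, algebraMap_eq]
    · simp
  · refine algHom_ext fun i ↦ ?_
    fin_cases i
    · simp [← mul_assoc, ← C_mul, algebraMap_eq]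
    · simp

lemma exists_swap (R : Type*) [CommRing R] :
    ∃ τ : MvPolynomial (Fin 2) R ≃ₐ[R] MvPolynomial (Fin 2) R, τ (X 0) = X 1 ∧ τ (X 1) = X 0 :=
  ⟨renameEquiv R (Equiv.swap 0 1), by simp, by simp⟩

/-- A surjection `ℂ[X, Y] → ℂ[t]` kills a coordinate. -/
lemma exists_algEquiv_map_X_eq_zero (φ : MvPolynomial (Fin 2) ℂ →ₐ[ℂ] Polynomial ℂ)
    (hφ : Function.Surjective φ) :
    ∃ σ : MvPolynomial (Fin 2) ℂ ≃ₐ[ℂ] MvPolynomial (Fin 2) ℂ, φ (σ (X 0)) = 0 := by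
  induction hN : (φ (X 0)).natDegree + (φ (X 1)).natDegree using Nat.strong_induction_on
    generalizing φ with
  | _ N ih =>
    obtain ⟨s, hs0, hs1⟩ := exists_swap ℂ
    have hconst (φ : MvPolynomial (Fin 2) ℂ →ₐ[ℂ] Polynomial ℂ) (h : (φ (X 1)).natDegree = 0) :
        ∃ σ : MvPolynomial (Fin 2) ℂ ≃ₐ[ℂ] MvPolynomial (Fin 2) ℂ, φ (σ (X 0)) = 0 := by
      obtain ⟨c, hc⟩ := Polynomial.natDegree_eq_zero.1 h
      obtain ⟨τ, -, hτ⟩ := exists_shear (Polynomial.C (-c))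
      refine ⟨s.trans τ, ?_⟩
      rw [AlgEquiv.trans_apply, hs0, hτ, map_add, ← hc]
      simp
    by_cases h1 : (φ (X 1)).natDegree = 0
    · exact hconst φ h1
    by_cases h0 : (φ (X 0)).natDegree = 0
    · obtain ⟨σ, hσ⟩ := hconst (φ.comp s.toAlgHom) (by simpa [hs1] using h0)
      exact ⟨σ.trans s, hσ⟩
    have hred (φ : MvPolynomial (Fin 2) ℂ →ₐ[ℂ] Polynomial ℂ) (hφ : Function.Surjective φ)
        (hN : (φ (X 0)).natDegree + (φ (X 1)).natDegree = N) (h0 : (φ (X 0)).natDegree ≠ 0)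
        (hle : (φ (X 0)).natDegree ≤ (φ (X 1)).natDegree) :
        ∃ σ : MvPolynomial (Fin 2) ℂ ≃ₐ[ℂ] MvPolynomial (Fin 2) ℂ, φ (σ (X 0)) = 0 := by
      obtain ⟨q, hq⟩ := Polynomial.natDegree_dvd_natDegree_of_surjective hφ h0 hle
      have hx0 : φ (X 0) ≠ 0 := fun h ↦ h0 (by rw [h, Polynomial.natDegree_zero])
      have hy0 : φ (X 1) ≠ 0 := fun h ↦ by
        rw [h, Polynomial.natDegree_zero] at hle
        omega
      set c := (φ (X 1)).leadingCoeff / (φ (X 0)).leadingCoeff ^ q with hc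
      have hc0 : c ≠ 0 := div_ne_zero (Polynomial.leadingCoeff_ne_zero.2 hy0)
        (pow_ne_zero _ (Polynomial.leadingCoeff_ne_zero.2 hx0))
      obtain ⟨τ, hτ0, hτ1⟩ := exists_shear (-(Polynomial.C c * Polynomial.X ^ q))
      have hφ1 : φ (τ (X 1)) = φ (X 1) - Polynomial.C c * φ (X 0) ^ q := by
        rw [hτ1, map_add, ← Polynomial.aeval_algHom_apply]
        simp [sub_eq_add_neg]
      have hdeg : (φ (τ (X 1))).natDegree < (φ (X 1)).natDegree := by
        have hlt : (φ (τ (X 1))).degree < (φ (X 1)).degree := by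
          rw [hφ1]
          refine Polynomial.degree_sub_lt_left ?_ hy0 ?_
          · rw [Polynomial.degree_eq_natDegree hy0, Polynomial.degree_C_mul hc0,
              Polynomial.degree_pow, Polynomial.degree_eq_natDegree hx0, hq]
            simp [mul_comm]
          · rw [Polynomial.leadingCoeff_mul, Polynomial.leadingCoeff_C,
              Polynomial.leadingCoeff_pow, hc, div_mul_cancel₀]
            exact pow_ne_zero _ (Polynomial.leadingCoeff_ne_zero.2 hx0)
        by_cases hz : φ (τ (X 1)) = 0
        · rw [hz, Polynomial.natDegree_zero]
          omega
        · exact Polynomial.natDegree_lt_natDegree hz hlt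
      obtain ⟨σ, hσ⟩ := ih ((φ (τ (X 0))).natDegree + (φ (τ (X 1))).natDegree)
        (by rw [hτ0]; omega) (φ.comp τ.toAlgHom) (hφ.comp τ.surjective) rfl
      exact ⟨σ.trans τ, hσ⟩
    rcases le_total (φ (X 0)).natDegree (φ (X 1)).natDegree with hle | hle
    · exact hred φ hφ hN h0 hle
    · obtain ⟨σ, hσ⟩ := hred (φ.comp s.toAlgHom) (hφ.comp s.surjective)
        (by simpa [hs0, hs1, add_comm] using hN) (by simpa [hs0] using h1)
        (by simpa [hs0, hs1] using hle)
      exact ⟨σ.trans s, hσ⟩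

end MvPolynomial

/-- **Theorem B (Abhyankar–Moh–Suzuki, curve form).**
If `f ∈ ℂ[X,Y]` is irreducible and the coordinate ring `ℂ[X,Y]/(f)` of the curve
`Z(f)` is `ℂ`-isomorphic to the one-variable polynomial ring `ℂ[t]` (i.e. the
curve is isomorphic to the affine line), then in some algebraic coordinates on
`ℂ²` the curve has equation `X = 0`. -/
theorem abhyankar_moh_suzuki
    (f : MvPolynomial (Fin 2) ℂ) (hf : Irreducible f)
    (hline : Nonempty
      ((MvPolynomial (Fin 2) ℂ ⧸ Ideal.span {f}) ≃ₐ[ℂ] Polynomial ℂ)) :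
    ∃ σ : MvPolynomial (Fin 2) ℂ ≃ₐ[ℂ] MvPolynomial (Fin 2) ℂ,
      σ f = X 0 := by
  obtain ⟨e⟩ := hline
  obtain ⟨σ, hσ⟩ := MvPolynomial.exists_algEquiv_map_X_eq_zero
    (e.toAlgHom.comp (Ideal.Quotient.mkₐ ℂ (Ideal.span {f})))
    (e.surjective.comp (Ideal.Quotient.mkₐ_surjective ℂ _))
  have hdvd : f ∣ σ (X 0) := by
    rw [← Ideal.mem_span_singleton, ← Ideal.Quotient.eq_zero_iff_mem]
    exact (map_eq_zero_iff e e.injective).1 hσ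
  have hirr : Irreducible (σ (X 0)) :=
    (MulEquiv.irreducible_iff σ).2 (MvPolynomial.X_prime (i := 0)).irreducible
  obtain ⟨w, hw⟩ := hf.associated_of_dvd hirr hdvd
  obtain ⟨c, hc, hcw⟩ := MvPolynomial.isUnit_iff_eq_C_of_isReduced.1 w.isUnit
  obtain ⟨u, rfl⟩ := hc
  obtain ⟨τ, hτ⟩ := MvPolynomial.exists_scale u
  refine ⟨σ.symm.trans τ, ?_⟩
  have h1 : σ.symm f * C (u : ℂ) = X 0 := by
    rw [← AlgEquiv.symm_apply_apply σ (X 0), ← hw, hcw, map_mul, ← algebraMap_eq,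
      AlgEquiv.commutes]
  have h2 := congrArg τ h1
  rw [map_mul, hτ, ← algebraMap_eq, AlgEquiv.commutes, mul_comm] at h2
  refine mul_left_cancel₀ ?_ h2
  rw [algebraMap_eq, C_ne_zero]
  exact u.ne_zero
end

section
/- (Abhyankar–Moh epimorphism theorem; equivalent formulation of Theorem B.) Let φ : ℂ[X,Y] → ℂ[t] be a surjective ℂ-algebra homomorphism from the polynomial ring in two variables to the polynomial ring in one variable. Then there exists a ℂ-algebra automorphism σ of ℂ[X,Y] such that (φ ∘ σ)(X) = t and (φ ∘ σ)(Y) = 0; that is, after a polynomial change of coordinates, φ is the standard projection X ↦ t, Y ↦ 0. -/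
namespace AbhyankarMoh

open Polynomial

section PolynomialExpansions

variable {R : Type*} [CommRing R]

lemma degree_mul_lt {p q : R[X]} {a b : ℕ} (hp : p.degree < a) (hq : q.natDegree ≤ b) :
    (p * q).degree < (a + b : ℕ) := by
  rcases eq_or_ne p 0 with rfl | h0
  · simp
  · have h1 : p.natDegree < a := (natDegree_lt_iff_degree_lt h0).2 hp
    refine degree_le_natDegree.trans_lt ?_
    have h2 := natDegree_mul_le (p := p) (q := q)
    exact_mod_cast (by omega : (p * q).natDegree < a + b)

lemma natDegree_le_of_degree_lt {p : R[X]} {a b : ℕ} (hp : p.degree < a) (hab : a ≤ b + 1) :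
    p.natDegree ≤ b := by
  rcases eq_or_ne p 0 with rfl | h0
  · simp
  · have h1 : p.natDegree < a := (natDegree_lt_iff_degree_lt h0).2 hp
    omega

lemma degree_lt_mono {p : R[X]} {a b : ℕ} (hp : p.degree < a) (hab : a ≤ b) : p.degree < b :=
  hp.trans_le (by exact_mod_cast hab)

lemma degree_sum_lt {ι : Type*} (s : Finset ι) (p : ι → R[X]) {a : ℕ}
    (hp : ∀ i ∈ s, (p i).degree < a) : (∑ i ∈ s, p i).degree < a := by
  rw [← mem_degreeLT]
  exact Submodule.sum_mem _ fun i hi => mem_degreeLT.2 (hp i hi)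

lemma degree_sub_lt' {p q : R[X]} {a : ℕ} (hp : p.degree < a) (hq : q.degree < a) :
    (p - q).degree < a := by
  rw [← mem_degreeLT] at *
  exact Submodule.sub_mem _ hp hq

lemma degree_add_lt' {p q : R[X]} {a : ℕ} (hp : p.degree < a) (hq : q.degree < a) :
    (p + q).degree < a := by
  rw [← mem_degreeLT] at *
  exact Submodule.add_mem _ hp hq

/-- Every polynomial of degree less than `m * N` has a `Q`-adic expansion with `m` digits, for
`Q` monic of degree `N`. -/
lemma exists_adic_expansion [Nontrivial R] {Q : R[X]} {N : ℕ} (hQ : Q.Monic)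
    (hN : Q.natDegree = N) :
    ∀ (m : ℕ) (H : R[X]), H.degree < (m * N : ℕ) → ∃ A : ℕ → R[X], (∀ l, (A l).degree < N) ∧
      H = ∑ l ∈ Finset.range m, A l * Q ^ l
  | 0, H, hH => by
      refine ⟨0, fun l => by simp, ?_⟩
      have : H.degree < 0 := by simpa using hH
      simpa using (Nat.WithBot.lt_zero_iff.1 this)
  | m + 1, H, hH => by
      have hQN : Q.degree = (N : WithBot ℕ) := by rw [degree_eq_natDegree hQ.ne_zero, hN]
      have hdiv : (H /ₘ Q).degree < (m * N : ℕ) := by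
        rcases eq_or_ne (H /ₘ Q) 0 with h0 | h0
        · rw [h0, degree_zero]; exact WithBot.bot_lt_coe _
        · have hle : Q.degree ≤ H.degree := by
            by_contra hlt
            exact h0 ((divByMonic_eq_zero_iff hQ).2 (not_le.1 hlt))
          have h1 := degree_add_divByMonic hQ hle
          have hH0 : H ≠ 0 := by rintro rfl; simp at h0
          have h2 : H.natDegree < (m + 1) * N := (natDegree_lt_iff_degree_lt hH0).2 hH
          rw [degree_eq_natDegree h0]
          rw [degree_eq_natDegree h0, hQN, degree_eq_natDegree hH0] at h1
          have h3 : N + (H /ₘ Q).natDegree = H.natDegree := by exact_mod_cast h1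
          have h4 : (m + 1) * N = m * N + N := by ring
          exact_mod_cast (by omega : (H /ₘ Q).natDegree < m * N)
      obtain ⟨A, hA, hsum⟩ := exists_adic_expansion hQ hN m _ hdiv
      refine ⟨fun l => if l = 0 then H %ₘ Q else A (l - 1), ?_, ?_⟩
      · intro l
        by_cases hl : l = 0
        · simpa [hl, ← hQN] using degree_modByMonic_lt H hQ
        · simpa [hl] using hA _
      · rw [Finset.sum_range_succ']
        simp only [Nat.add_eq_zero_iff, one_ne_zero, and_false, if_false, Nat.add_sub_cancel,
          if_true, pow_zero, mul_one, pow_succ, ← mul_assoc]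
        rw [← Finset.sum_mul, ← hsum]
        nth_rw 1 [← modByMonic_add_div H Q]
        ring

/-- The error in the linear approximation of `(Q + B) ^ (d + 1)` has small degree if `B` has. -/
lemma degree_add_pow_sub_lt {Q B : R[X]} {N k : ℕ} (hQ : Q.natDegree ≤ N) (hk : k < N)
    (hB : B.degree < (N - k : ℕ)) (d : ℕ) :
    ((Q + B) ^ (d + 1) - Q ^ (d + 1) - (d + 1 : ℕ) * B * Q ^ d).degree
      < ((d + 1) * N - k - 1 : ℕ) := by
  have hBN : B.natDegree ≤ N - k - 1 := natDegree_le_of_degree_lt hB (by omega)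
  induction d with
  | zero =>
    have : (Q + B) ^ (0 + 1) - Q ^ (0 + 1) - (0 + 1 : ℕ) * B * Q ^ 0 = 0 := by push_cast; ring
    rw [this]
    simp
  | succ d ih =>
    have h1 : (Q + B) ^ (d + 1 + 1) - Q ^ (d + 1 + 1) - (d + 1 + 1 : ℕ) * B * Q ^ (d + 1)
        = ((Q + B) ^ (d + 1) - Q ^ (d + 1) - (d + 1 : ℕ) * B * Q ^ d) * (Q + B)
          + B * (((d + 1 : ℕ) : R[X]) * B * Q ^ d) := by
      push_cast; ring
    rw [h1]
    have h3 : N ≤ (d + 1) * N := Nat.le_mul_of_pos_left N (by omega)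
    have h4 : (d + 1 + 1) * N = (d + 1) * N + N := by ring
    have h5 : (d + 1) * N = d * N + N := by ring
    refine degree_add_lt' ?_ ?_
    · refine degree_lt_mono (degree_mul_lt ih (b := N) ?_) (by omega)
      exact (natDegree_add_le _ _).trans (max_le hQ (by omega))
    · refine degree_lt_mono (degree_mul_lt hB (b := N - k - 1 + d * N) ?_) (by omega)
      refine natDegree_mul_le_of_le ?_ (natDegree_pow_le_of_le d hQ)
      refine (natDegree_mul_le_of_le (m := 0) ?_ hBN).trans (by simp)
      exact (natDegree_natCast (R := R) (d + 1)).le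

/-- Existence of approximate roots. -/
lemma exists_approximate_root [Nontrivial R] {P : R[X]} {d N : ℕ} (hP : P.Monic)
    (hdeg : P.natDegree = (d + 1) * N) (hd : IsUnit ((d + 1 : ℕ) : R)) :
    ∀ k ≤ N, ∃ G : R[X], G.Monic ∧ G.natDegree = N ∧
      (P - G ^ (d + 1)).degree < ((d + 1) * N - k : ℕ)
  | 0, _ => by
      refine ⟨X ^ N, monic_X_pow N, natDegree_X_pow N, ?_⟩
      have h : P.degree = ((d + 1) * N : ℕ) := by rw [degree_eq_natDegree hP.ne_zero, hdeg]
      rw [Nat.sub_zero, ← h]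
      refine degree_sub_lt_left ?_ hP.ne_zero ?_
      · rw [h, ← pow_mul, degree_X_pow, mul_comm N]
      · rw [hP.leadingCoeff, ((monic_X_pow N).pow _).leadingCoeff]
  | k + 1, hk => by
      obtain ⟨G, hG, hGN, hGd⟩ := exists_approximate_root hP hdeg hd k (by omega)
      obtain ⟨u, hu⟩ := hd.exists_right_inv
      set c := (P - G ^ (d + 1)).coeff ((d + 1) * N - k - 1) with hc
      set B : R[X] := C (u * c) * X ^ (N - k - 1) with hB
      have hBd : B.degree < (N - k : ℕ) :=
        (degree_C_mul_X_pow_le _ _).trans_lt (by exact_mod_cast (by omega : N - k - 1 < N - k))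
      have hBN : B.degree < G.degree := by
        rw [degree_eq_natDegree hG.ne_zero, hGN]
        exact degree_lt_mono hBd (by omega)
      have h3 : N ≤ (d + 1) * N := Nat.le_mul_of_pos_left N (by omega)
      have h5 : (d + 1) * N = d * N + N := by ring
      refine ⟨G + B, hG.add_of_left hBN, ?_, ?_⟩
      · rw [natDegree_add_eq_left_of_degree_lt hBN, hGN]
      · have herr := degree_add_pow_sub_lt (Q := G) (N := N) hGN.le (by omega : k < N) hBd d
        have h6 : P - (G + B) ^ (d + 1) = (P - G ^ (d + 1) - (d + 1 : ℕ) * B * G ^ d)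
            - ((G + B) ^ (d + 1) - G ^ (d + 1) - (d + 1 : ℕ) * B * G ^ d) := by ring
        rw [h6]
        refine degree_sub_lt' ?_ (degree_lt_mono herr (by omega))
        have h7 : ((d + 1 : ℕ) : R[X]) * B * G ^ d = C c * (X ^ (N - k - 1) * G ^ d) := by
          have : ((d + 1 : ℕ) : R[X]) * C (u * c) = C c := by
            rw [← C_eq_natCast, ← C_mul, ← mul_assoc, hu, one_mul]
          rw [hB, ← this]; ring
        rw [h7]
        have hm : (X ^ (N - k - 1) * G ^ d).Monic := (monic_X_pow _).mul (hG.pow d)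
        have hmd : (X ^ (N - k - 1) * G ^ d).natDegree = (d + 1) * N - k - 1 := by
          rw [Monic.natDegree_mul (monic_X_pow _) (hG.pow d), natDegree_X_pow, hG.natDegree_pow,
            hGN]
          omega
        rw [degree_lt_iff_coeff_zero] at hGd ⊢
        intro i hi
        rcases eq_or_lt_of_le hi with h | h
        · have : (X ^ (N - k - 1) * G ^ d).coeff i = 1 := by
            have := hm.coeff_natDegree
            rwa [hmd, (by omega : (d + 1) * N - k - 1 = i)] at this
          rw [coeff_sub, coeff_C_mul, this, hc, (by omega : (d + 1) * N - k - 1 = i)]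
          ring
        · rw [coeff_sub, coeff_C_mul, hGd i (by omega),
            coeff_eq_zero_of_natDegree_lt (p := X ^ (N - k - 1) * G ^ d) (by omega)]
          ring

/-- Uniqueness of approximate roots. -/
lemma approximate_root_unique {F : Type*} [Field F] [CharZero F] {P G₁ G₂ : F[X]} {d N : ℕ}
    (hG₁ : G₁.Monic) (hG₂ : G₂.Monic) (hN₁ : G₁.natDegree = N) (hN₂ : G₂.natDegree = N)
    (h₁ : (P - G₁ ^ (d + 1)).degree < (d * N : ℕ)) (h₂ : (P - G₂ ^ (d + 1)).degree < (d * N : ℕ)) :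
    G₁ = G₂ := by
  by_contra hne
  have hB0 : G₁ - G₂ ≠ 0 := sub_ne_zero.2 hne
  set B := G₁ - G₂ with hB
  have hBlt : B.degree < N := by
    have h : G₁.degree = N := by rw [degree_eq_natDegree hG₁.ne_zero, hN₁]
    rw [← h]
    refine degree_sub_lt_left ?_ hG₁.ne_zero ?_
    · rw [h, degree_eq_natDegree hG₂.ne_zero, hN₂]
    · rw [hG₁.leadingCoeff, hG₂.leadingCoeff]
  have hb : B.natDegree < N := (natDegree_lt_iff_degree_lt hB0).2 hBlt
  have herr := degree_add_pow_sub_lt (Q := G₂) (B := B) (N := N) (k := N - B.natDegree - 1)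
    hN₂.le (by omega) (degree_le_natDegree.trans_lt
      (by exact_mod_cast (by omega : B.natDegree < N - (N - B.natDegree - 1)))) d
  have h5 : (d + 1) * N = d * N + N := by ring
  have hlin : ((d + 1 : ℕ) * B * G₂ ^ d : F[X]).degree < (d * N + B.natDegree : ℕ) := by
    have : ((d + 1 : ℕ) * B * G₂ ^ d : F[X]) = (P - G₂ ^ (d + 1)) - (P - G₁ ^ (d + 1))
        - ((G₂ + B) ^ (d + 1) - G₂ ^ (d + 1) - (d + 1 : ℕ) * B * G₂ ^ d) := by
      rw [hB]; ring
    rw [this]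
    exact degree_sub_lt' (degree_sub_lt' (degree_lt_mono h₂ (by omega))
      (degree_lt_mono h₁ (by omega))) (degree_lt_mono herr (by omega))
  have hd : ((d + 1 : ℕ) : F[X]) ≠ 0 := by exact_mod_cast Nat.succ_ne_zero d
  have hne0 : ((d + 1 : ℕ) * B * G₂ ^ d : F[X]) ≠ 0 :=
    mul_ne_zero (mul_ne_zero hd hB0) (pow_ne_zero _ hG₂.ne_zero)
  have := (natDegree_lt_iff_degree_lt hne0).2 hlin
  rw [natDegree_mul (mul_ne_zero hd hB0) (pow_ne_zero _ hG₂.ne_zero), natDegree_mul hd hB0,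
    natDegree_natCast, natDegree_pow, hN₂] at this
  omega

end PolynomialExpansions

section RamifiedDegree

variable {F L : Type*} [Field F] [Field L]

/-- `x` is zero or has degree at most `w`. -/
def InBall (v : L → ℤ) (w : ℤ) (x : L) : Prop := x ≠ 0 → v x ≤ w

/-- A degree function `v` on `L`, totally ramified of index `n` over the field `F` of constants,
together with an evaluation map `θ : F[X] → L` which is injective in degrees less than `n`. -/
structure RamifiedDegree (θ : F[X] →+* L) (v : L → ℤ) (n : ℕ) : Prop where
  map_mul : ∀ x y, x ≠ 0 → y ≠ 0 → v (x * y) = v x + v y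
  map_add_le : ∀ x y, x ≠ 0 → y ≠ 0 → x + y ≠ 0 → v (x + y) ≤ max (v x) (v y)
  dvd_const : ∀ a : F, a ≠ 0 → (n : ℤ) ∣ v (θ (C a))
  exists_const : ∀ k : ℤ, ∃ a : F, a ≠ 0 ∧ v (θ (C a)) = n * k
  residue : ∀ x y, x ≠ 0 → y ≠ 0 → v x = v y →
    ∃ c : F, x - θ (C c) * y ≠ 0 → v (x - θ (C c) * y) < v x
  map_ne_zero : ∀ H : F[X], H ≠ 0 → H.degree < n → θ H ≠ 0
  map_natCast : ∀ m : ℕ, m ≠ 0 → v (m : L) = 0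
  bddBelow : ∃ c : ℤ, ∀ H : F[X], H.Monic → H.degree < n → c ≤ v (θ H)

namespace RamifiedDegree

variable {θ : F[X] →+* L} {v : L → ℤ} {n : ℕ} (hv : RamifiedDegree θ v n)
include hv

lemma map_one : v 1 = 0 := by
  have := hv.map_mul 1 1 one_ne_zero one_ne_zero
  rw [mul_one] at this; omega

lemma map_neg (x : L) : v (-x) = v x := by
  have h1 : v (-1) = 0 := by
    have := hv.map_mul (-1) (-1) (by simp) (by simp)
    rw [neg_mul_neg, mul_one, hv.map_one] at this; omega
  rcases eq_or_ne x 0 with rfl | hx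
  · simp
  · have := hv.map_mul (-1) x (by simp) hx
    rw [neg_one_mul] at this; omega

lemma map_pow {x : L} (hx : x ≠ 0) (k : ℕ) : v (x ^ k) = k * v x := by
  induction k with
  | zero => simp [hv.map_one]
  | succ k ih => rw [pow_succ, hv.map_mul _ _ (pow_ne_zero _ hx) hx, ih]; push_cast; ring

omit hv in
lemma ball_zero (w : ℤ) : InBall v w 0 := fun h => absurd rfl h

omit hv in
lemma ball_mono {w w' : ℤ} {x : L} (hx : InBall v w x) (h : w ≤ w') : InBall v w' x :=
  fun h0 => (hx h0).trans h

lemma ball_add {w : ℤ} {x y : L} (hx : InBall v w x) (hy : InBall v w y) :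
    InBall v w (x + y) := by
  intro h
  rcases eq_or_ne x 0 with rfl | hx0
  · rw [zero_add] at *; exact hy h
  rcases eq_or_ne y 0 with rfl | hy0
  · rw [add_zero] at *; exact hx h
  exact (hv.map_add_le x y hx0 hy0 h).trans (max_le (hx hx0) (hy hy0))

lemma ball_neg {w : ℤ} {x : L} (hx : InBall v w x) : InBall v w (-x) := by
  intro h
  rw [hv.map_neg]
  exact hx (neg_ne_zero.1 h)

lemma ball_sub {w : ℤ} {x y : L} (hx : InBall v w x) (hy : InBall v w y) :
    InBall v w (x - y) := by
  rw [sub_eq_add_neg]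
  exact hv.ball_add hx (hv.ball_neg hy)

lemma ball_mul {w w' : ℤ} {x y : L} (hx : InBall v w x) (hy : InBall v w' y) :
    InBall v (w + w') (x * y) := by
  intro h
  have hx0 := left_ne_zero_of_mul h
  have hy0 := right_ne_zero_of_mul h
  rw [hv.map_mul x y hx0 hy0]
  exact add_le_add (hx hx0) (hy hy0)

lemma add_of_lt {x y : L} (hx : x ≠ 0) (hy : InBall v (v x - 1) y) :
    x + y ≠ 0 ∧ v (x + y) = v x := by
  rcases eq_or_ne y 0 with rfl | hy0
  · simpa using hx
  have hy1 := hy hy0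
  have hne : x + y ≠ 0 := by
    intro h
    rw [eq_neg_of_add_eq_zero_left h, hv.map_neg] at hy1
    omega
  refine ⟨hne, le_antisymm ?_ ?_⟩
  · exact (hv.map_add_le x y hx hy0 hne).trans (max_le le_rfl (by omega))
  · have h1 := hv.map_add_le (x + y) (-y) hne (neg_ne_zero.2 hy0) (by simpa using hx)
    rw [add_neg_cancel_right, hv.map_neg] at h1
    rcases le_max_iff.1 h1 with h | h <;> omega

lemma sum_of_distinct {ι : Type*} (s : Finset ι) (x : ι → L)
    (hdist : ∀ i ∈ s, ∀ j ∈ s, x i ≠ 0 → x j ≠ 0 → v (x i) = v (x j) → i = j)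
    (hne : ∃ i ∈ s, x i ≠ 0) :
    ∑ i ∈ s, x i ≠ 0 ∧ ∃ i ∈ s, x i ≠ 0 ∧ v (∑ i ∈ s, x i) = v (x i) ∧
      ∀ j ∈ s, InBall v (v (x i)) (x j) := by
  classical
  induction s using Finset.induction_on with
  | empty => simp at hne
  | insert a s ha ih =>
    rw [Finset.sum_insert ha]
    by_cases hs : ∃ i ∈ s, x i ≠ 0
    · obtain ⟨h0, i, his, hi0, hvi, hball⟩ := ih (fun i hi j hj =>
        hdist i (Finset.mem_insert_of_mem hi) j (Finset.mem_insert_of_mem hj)) hs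
      rcases eq_or_ne (x a) 0 with hxa | hxa
      · rw [hxa, zero_add]
        refine ⟨h0, i, Finset.mem_insert_of_mem his, hi0, hvi, ?_⟩
        intro j hj
        rcases Finset.mem_insert.1 hj with rfl | hj
        · rw [hxa]; exact ball_zero _
        · exact hball j hj
      · rcases lt_trichotomy (v (x a)) (v (x i)) with h | h | h
        · obtain ⟨h1, h2⟩ := hv.add_of_lt h0 (y := x a) (fun _ => by omega)
          rw [add_comm]
          refine ⟨h1, i, Finset.mem_insert_of_mem his, hi0, by omega, ?_⟩
          intro j hj
          rcases Finset.mem_insert.1 hj with rfl | hj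
          · exact fun _ => h.le
          · exact hball j hj
        · exact absurd (hdist a (Finset.mem_insert_self _ _) i (Finset.mem_insert_of_mem his)
            hxa hi0 h) (by rintro rfl; exact ha his)
        · obtain ⟨h1, h2⟩ := hv.add_of_lt hxa (y := ∑ i ∈ s, x i) (fun _ => by omega)
          refine ⟨h1, a, Finset.mem_insert_self _ _, hxa, h2, ?_⟩
          intro j hj
          rcases Finset.mem_insert.1 hj with rfl | hj
          · exact fun _ => le_rfl
          · exact ball_mono (hball j hj) h.le
    · push Not at hs
      rw [Finset.sum_eq_zero hs, add_zero]
      obtain ⟨i, hi, hi0⟩ := hne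
      have hia : i = a := by
        rcases Finset.mem_insert.1 hi with h | h
        · exact h
        · exact absurd (hs i h) hi0
      subst hia
      refine ⟨hi0, i, Finset.mem_insert_self _ _, hi0, rfl, ?_⟩
      intro j hj
      rcases Finset.mem_insert.1 hj with rfl | hj
      · exact fun _ => le_rfl
      · rw [hs j hj]; exact ball_zero _

end RamifiedDegree

lemma dvd_of_dvd_mul_quotient {d : ℕ} (hd : 0 < d) {δ j : ℤ} (h : (d : ℤ) ∣ j * δ) :
    ((d / Int.gcd d δ : ℕ) : ℤ) ∣ j := by
  have he : 0 < Int.gcd d δ := Int.gcd_pos_of_ne_zero_left _ (by exact_mod_cast hd.ne')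
  have h1 : ((d / Int.gcd d δ : ℕ) : ℤ) ∣ j * (δ / Int.gcd d δ) := by
    rw [Int.natCast_div]
    obtain ⟨a, ha⟩ := Int.gcd_dvd_left (d : ℤ) δ
    obtain ⟨b, hb⟩ := Int.gcd_dvd_right (d : ℤ) δ
    set e : ℤ := (Int.gcd d δ : ℤ) with hedef
    have he' : e ≠ 0 := by rw [hedef]; exact_mod_cast he.ne'
    rw [ha, hb, Int.mul_ediv_cancel_left _ he', Int.mul_ediv_cancel_left _ he']
    rw [ha, hb, mul_left_comm] at h
    exact (mul_dvd_mul_iff_left he').1 h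
  refine IsCoprime.dvd_of_dvd_mul_right ?_ h1
  rw [Int.isCoprime_iff_gcd_eq_one, Int.natCast_div]
  exact Int.gcd_ediv_gcd_ediv_gcd he

/-- The polynomials of degree less than `N` take exactly the degrees divisible by `d`. -/
structure Level (θ : F[X] →+* L) (v : L → ℤ) (n d N : ℕ) : Prop where
  pos : 0 < n
  mul_eq : d * N = n
  dvd : ∀ H : F[X], H.degree < N → θ H ≠ 0 → (d : ℤ) ∣ v (θ H)
  exists_eq : ∀ k : ℤ, ∃ H : F[X], H.degree < N ∧ θ H ≠ 0 ∧ v (θ H) = d * k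

/-- `Q` is a key polynomial at the given level. -/
structure IsKey (θ : F[X] →+* L) (v : L → ℤ) (d N : ℕ) (δ : ℤ) (Q : F[X]) : Prop where
  monic : Q.Monic
  natDegree : Q.natDegree = N
  ne_zero : θ Q ≠ 0
  value : v (θ Q) = δ
  not_dvd : ¬ (d : ℤ) ∣ δ

/-- Sums `∑_{l < m} A_l Q ^ l` all of whose terms have formal degree at most `w`. -/
def Filtered (θ : F[X] →+* L) (v : L → ℤ) (N : ℕ) (δ : ℤ) (Q : F[X]) (m : ℕ) (w : ℤ)
    (H : F[X]) : Prop :=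
  ∃ A : ℕ → F[X], (∀ l, (A l).degree < N) ∧ (∀ l : ℕ, InBall v (w - l * δ) (θ (A l))) ∧
    H = ∑ l ∈ Finset.range m, A l * Q ^ l

variable {θ : F[X] →+* L} {v : L → ℤ} {n d N : ℕ} {δ : ℤ} {Q : F[X]}

lemma Level.d_pos (hl : Level θ v n d N) : 0 < d :=
  Nat.pos_of_ne_zero fun h => hl.pos.ne' (by rw [← hl.mul_eq, h, zero_mul])

lemma Level.N_pos (hl : Level θ v n d N) : 0 < N :=
  Nat.pos_of_ne_zero fun h => hl.pos.ne' (by rw [← hl.mul_eq, h, mul_zero])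

lemma Level.initial (hv : RamifiedDegree θ v n) (hn : 0 < n) : Level θ v n n 1 where
  pos := hn
  mul_eq := mul_one n
  dvd H hH h0 := by
    have hH' : H.degree ≤ 0 := by
      have := natDegree_le_of_degree_lt hH (b := 0) (by omega)
      exact natDegree_eq_zero_iff_degree_le_zero.1 (by omega)
    rw [eq_C_of_degree_le_zero hH'] at h0 ⊢
    exact hv.dvd_const _ (by intro h; simp [h] at h0)
  exists_eq k := by
    obtain ⟨a, ha, hk⟩ := hv.exists_const k
    have h1 : (C a).degree < (1 : ℕ) := degree_C_le.trans_lt (by norm_num)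
    exact ⟨C a, h1, hv.map_ne_zero _ (C_ne_zero.2 ha) (degree_lt_mono h1 hn), hk⟩

lemma Level.sum_value (hv : RamifiedDegree θ v n) (hl : Level θ v n d N)
    (hQ : IsKey θ v d N δ Q) {m : ℕ} (hm : m ≤ d / Int.gcd d δ) {A : ℕ → F[X]}
    (hA : ∀ l, (A l).degree < N) (hne : ∃ l < m, θ (A l) ≠ 0) :
    θ (∑ l ∈ Finset.range m, A l * Q ^ l) ≠ 0 ∧ ∃ l < m, θ (A l) ≠ 0 ∧
      v (θ (∑ l ∈ Finset.range m, A l * Q ^ l)) = v (θ (A l)) + l * δ ∧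
      ∀ l' < m, InBall v (v (θ (∑ l ∈ Finset.range m, A l * Q ^ l)) - l' * δ) (θ (A l')) := by
  have hval : ∀ l : ℕ, θ (A l) ≠ 0 → v (θ (A l * Q ^ l)) = v (θ (A l)) + l * δ := by
    intro l h0
    rw [map_mul, map_pow, hv.map_mul _ _ h0 (pow_ne_zero _ hQ.ne_zero), hv.map_pow hQ.ne_zero,
      hQ.value]
  have hnz : ∀ l : ℕ, θ (A l * Q ^ l) ≠ 0 ↔ θ (A l) ≠ 0 := by
    intro l
    rw [map_mul, map_pow, mul_ne_zero_iff, and_iff_left (pow_ne_zero _ hQ.ne_zero)]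
  have key := hv.sum_of_distinct (Finset.range m) (fun l => θ (A l * Q ^ l)) ?_ ?_
  · rw [map_sum]
    obtain ⟨h0, l, hlm, hl0, hvl, hball⟩ := key
    rw [hnz] at hl0
    refine ⟨h0, l, Finset.mem_range.1 hlm, hl0, by rw [hvl, hval l hl0], ?_⟩
    intro l' hl' h0'
    have := hball l' (Finset.mem_range.2 hl') ((hnz l').2 h0')
    rw [hval l' h0'] at this
    omega
  · intro i hi j hj hi0 hj0 hij
    rw [hnz] at hi0 hj0
    simp only [hval i hi0, hval j hj0] at hij
    have h1 : (d : ℤ) ∣ ((i : ℤ) - j) * δ := by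
      have : ((i : ℤ) - j) * δ = v (θ (A j)) - v (θ (A i)) := by linear_combination hij
      rw [this]
      exact dvd_sub (hl.dvd _ (hA j) hj0) (hl.dvd _ (hA i) hi0)
    have h2 := dvd_of_dvd_mul_quotient hl.d_pos h1
    have h3 := Int.eq_zero_of_abs_lt_dvd h2
      (by rw [Finset.mem_range] at hi hj; rw [abs_lt]; constructor <;> omega)
    omega
  · obtain ⟨l, hlm, hl0⟩ := hne
    exact ⟨l, Finset.mem_range.2 hlm, (hnz l).2 hl0⟩

lemma Level.filtered_of_ball (hv : RamifiedDegree θ v n) (hl : Level θ v n d N)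
    (hQ : IsKey θ v d N δ Q) {m : ℕ} (hm : m ≤ d / Int.gcd d δ) {H : F[X]}
    (hH : H.degree < (m * N : ℕ)) {w : ℤ} (hw : InBall v w (θ H)) :
    Filtered θ v N δ Q m w H := by
  obtain ⟨A, hA, rfl⟩ := exists_adic_expansion hQ.monic hQ.natDegree m H hH
  refine ⟨fun l => if l < m then A l else 0, ?_, ?_, ?_⟩
  · intro l
    by_cases h : l < m
    · simpa [h] using hA l
    · simp [h]
  · intro l
    by_cases h : l < m
    · simp only [h, if_true]
      by_cases h0 : θ (A l) = 0
      · rw [h0]; exact RamifiedDegree.ball_zero _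
      · obtain ⟨h1, _, _, _, _, h2⟩ := hl.sum_value hv hQ hm hA ⟨l, h, h0⟩
        have := hw h1
        exact RamifiedDegree.ball_mono (h2 l h) (by omega)
    · simp only [h, if_false, map_zero]
      exact RamifiedDegree.ball_zero _
  · refine Finset.sum_congr rfl fun l hl => ?_
    simp [Finset.mem_range.1 hl]

lemma Level.exists_key (hv : RamifiedDegree θ v n) (hl : Level θ v n d N) (hd : 1 < d) :
    ∃ (Q : F[X]) (δ : ℤ), IsKey θ v d N δ Q ∧
      ∀ Q' : F[X], Q'.Monic → Q'.natDegree = N → δ ≤ v (θ Q') := by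
  have hNn : N < n := by rw [← hl.mul_eq]; nlinarith [hl.N_pos]
  have hlt : ∀ Q : F[X], Q.Monic → Q.natDegree = N → Q.degree < n := by
    intro Q hQ hQN
    rw [degree_eq_natDegree hQ.ne_zero, hQN]; exact_mod_cast hNn
  obtain ⟨c, hc⟩ := hv.bddBelow
  obtain ⟨δ, ⟨Q, hQ, hQN, rfl⟩, hmin⟩ := Int.exists_least_of_bdd
    (P := fun z => ∃ Q : F[X], Q.Monic ∧ Q.natDegree = N ∧ v (θ Q) = z)
    ⟨c, by rintro z ⟨Q, hQ, hQN, rfl⟩; exact hc Q hQ (hlt Q hQ hQN)⟩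
    ⟨_, X ^ N, monic_X_pow N, natDegree_X_pow N, rfl⟩
  have hQ0 := hv.map_ne_zero Q hQ.ne_zero (hlt Q hQ hQN)
  refine ⟨Q, _, ⟨hQ, hQN, hQ0, rfl, ?_⟩, fun Q' h1 h2 => hmin _ ⟨Q', h1, h2, rfl⟩⟩
  rintro ⟨k, hk⟩
  obtain ⟨H, hHN, hH0, hHk⟩ := hl.exists_eq k
  obtain ⟨a, ha⟩ := hv.residue (θ Q) (θ H) hQ0 hH0 (by rw [hk, hHk])
  have hlt' : (C a * H).degree < Q.degree := by
    rw [degree_eq_natDegree hQ.ne_zero, hQN, mul_comm]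
    exact degree_mul_lt hHN (b := 0) (by simp)
  have hm : (Q - C a * H).Monic := hQ.sub_of_left hlt'
  have hmN : (Q - C a * H).natDegree = N := by
    rw [natDegree_sub_eq_left_of_natDegree_lt, hQN]
    rcases eq_or_ne (C a * H) 0 with h0 | h0
    · rw [h0, natDegree_zero, hQN]; exact hl.N_pos
    · exact natDegree_lt_natDegree h0 hlt'
  have h0 := hv.map_ne_zero _ hm.ne_zero (hlt _ hm hmN)
  have h1 := hmin _ ⟨_, hm, hmN, rfl⟩
  rw [map_sub, map_mul] at h0 h1
  exact absurd (ha h0) (not_lt.2 h1)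

lemma gcd_mul_quotient (d : ℕ) (δ : ℤ) :
    Int.gcd d δ * (d / Int.gcd d δ) = d :=
  Nat.mul_div_cancel' (by exact_mod_cast Int.gcd_dvd_left (d : ℤ) δ)

lemma Level.next (hv : RamifiedDegree θ v n) (hl : Level θ v n d N) (hQ : IsKey θ v d N δ Q) :
    Level θ v n (Int.gcd d δ) (d / Int.gcd d δ * N) where
  pos := hl.pos
  mul_eq := by rw [← mul_assoc, gcd_mul_quotient, hl.mul_eq]
  dvd H hH h0 := by
    obtain ⟨A, hA, rfl⟩ := exists_adic_expansion hQ.monic hQ.natDegree _ H hH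
    have hex : ∃ l < d / Int.gcd d δ, θ (A l) ≠ 0 := by
      by_contra hcon
      push Not at hcon
      refine h0 ?_
      rw [map_sum]
      exact Finset.sum_eq_zero fun l hlm => by
        rw [map_mul, hcon l (Finset.mem_range.1 hlm), zero_mul]
    obtain ⟨-, l, -, hl0, hval, -⟩ := hl.sum_value hv hQ le_rfl hA hex
    rw [hval]
    exact dvd_add ((Int.gcd_dvd_left (d : ℤ) δ).trans (hl.dvd _ (hA l) hl0))
      ((Int.gcd_dvd_right (d : ℤ) δ).mul_left _)
  exists_eq k := by
    set e := Int.gcd d δ with he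
    have hq : (e : ℤ) * (d / e : ℕ) = d := by exact_mod_cast gcd_mul_quotient d δ
    have hq0 : 0 < d / e := Nat.pos_of_ne_zero fun h => by
      have := gcd_mul_quotient d δ
      rw [← he, h] at this
      exact hl.d_pos.ne' (by simpa using this.symm)
    obtain ⟨b, hb⟩ := Int.gcd_dvd_right (d : ℤ) δ
    rw [← he] at hb
    have hbez := Int.gcd_eq_gcd_ab (d : ℤ) δ
    rw [← he] at hbez
    set x := Int.gcdA (d : ℤ) δ
    set y := Int.gcdB (d : ℤ) δ
    set q := d / e with hqdef
    have hqz : (0 : ℤ) < q := by exact_mod_cast hq0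
    obtain ⟨l, hl'⟩ := Int.eq_ofNat_of_zero_le (Int.emod_nonneg (y * k) hqz.ne')
    have hlq : l < q := by
      have := Int.emod_lt_of_pos (y * k) hqz
      omega
    have hdm := Int.mul_ediv_add_emod (y * k) q
    set s := y * k / q
    obtain ⟨A, hA, hA0, hAv⟩ := hl.exists_eq (x * k + b * s)
    refine ⟨A * Q ^ l, ?_, ?_, ?_⟩
    · refine degree_lt_mono (degree_mul_lt hA (b := l * N)
        (natDegree_pow_le_of_le l hQ.natDegree.le)) ?_
      calc N + l * N = (l + 1) * N := by ring
        _ ≤ q * N := Nat.mul_le_mul_right N hlq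
    · rw [map_mul, map_pow]
      exact mul_ne_zero hA0 (pow_ne_zero _ hQ.ne_zero)
    · rw [map_mul, map_pow, hv.map_mul _ _ hA0 (pow_ne_zero _ hQ.ne_zero), hv.map_pow hQ.ne_zero,
        hQ.value, hAv]
      rw [hl'] at hdm
      linear_combination (-k) * hbez + δ * hdm - s * q * hb - b * s * hq

end RamifiedDegree

section KeyPolynomials

variable {F L : Type*} [Field F] [Field L]
variable {θ : F[X] →+* L} {v : L → ℤ} {n d N : ℕ} {δ : ℤ} {Q : F[X]}

lemma Filtered.zero (m : ℕ) (w : ℤ) : Filtered θ v N δ Q m w 0 :=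
  ⟨0, by simp, fun l => by simpa using RamifiedDegree.ball_zero _, by simp⟩

lemma Filtered.add (hv : RamifiedDegree θ v n) {m : ℕ} {w : ℤ} {H H' : F[X]}
    (h : Filtered θ v N δ Q m w H) (h' : Filtered θ v N δ Q m w H') :
    Filtered θ v N δ Q m w (H + H') := by
  obtain ⟨A, hA, hAw, rfl⟩ := h
  obtain ⟨A', hA', hAw', rfl⟩ := h'
  refine ⟨A + A', fun l => degree_add_lt' (hA l) (hA' l), fun l => ?_, ?_⟩
  · rw [Pi.add_apply, map_add]; exact hv.ball_add (hAw l) (hAw' l)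
  · simp only [Pi.add_apply, add_mul, Finset.sum_add_distrib]

lemma Filtered.sum (hv : RamifiedDegree θ v n) {ι : Type*} (s : Finset ι) {H : ι → F[X]}
    {m : ℕ} {w : ℤ} (h : ∀ i ∈ s, Filtered θ v N δ Q m w (H i)) :
    Filtered θ v N δ Q m w (∑ i ∈ s, H i) :=
  Finset.sum_induction _ _ (fun _ _ => Filtered.add hv) (Filtered.zero m w) h

lemma Filtered.single {A : F[X]} {w : ℤ} {l m : ℕ} (hA : A.degree < N)
    (hw : InBall v (w - l * δ) (θ A)) (hlm : l < m) : Filtered θ v N δ Q m w (A * Q ^ l) := by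
  refine ⟨fun i => if i = l then A else 0, ?_, ?_, ?_⟩
  · intro i
    by_cases h : i = l
    · simpa [h] using hA
    · simp [h]
  · intro i
    by_cases h : i = l
    · subst h; simpa using hw
    · simpa [h] using RamifiedDegree.ball_zero _
  · simp [ite_mul, Finset.sum_ite_eq', hlm]

lemma Filtered.mono (hv : RamifiedDegree θ v n) {m m' : ℕ} {w w' : ℤ} {H : F[X]}
    (h : Filtered θ v N δ Q m w H) (hm : m ≤ m') (hw : w ≤ w') :
    Filtered θ v N δ Q m' w' H := by
  obtain ⟨A, hA, hAw, rfl⟩ := h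
  refine Filtered.sum hv _ fun l hl => ?_
  exact Filtered.single (hA l) (RamifiedDegree.ball_mono (hAw l) (by omega))
    ((Finset.mem_range.1 hl).trans_le hm)

lemma Filtered.mul_pow (hv : RamifiedDegree θ v n) {m : ℕ} {w : ℤ} {H : F[X]}
    (h : Filtered θ v N δ Q m w H) (k : ℕ) :
    Filtered θ v N δ Q (m + k) (w + k * δ) (H * Q ^ k) := by
  obtain ⟨A, hA, hAw, rfl⟩ := h
  rw [Finset.sum_mul]
  refine Filtered.sum hv _ fun l hl => ?_
  rw [mul_assoc, ← pow_add]
  refine Filtered.single (hA l) (RamifiedDegree.ball_mono (hAw l) ?_) ?_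
  · push_cast; linarith
  · have := Finset.mem_range.1 hl
    omega

lemma two_le_quotient (hl : Level θ v n d N) (hQ : IsKey θ v d N δ Q) :
    2 ≤ d / Int.gcd d δ := by
  have h := gcd_mul_quotient d δ
  have hd := hl.d_pos
  by_contra hlt
  rcases Nat.le_one_iff_eq_zero_or_eq_one.1 (Nat.lt_succ_iff.1 (not_le.1 hlt)) with h1 | h1
  · rw [h1, mul_zero] at h; omega
  · rw [h1, mul_one] at h
    refine hQ.not_dvd ?_
    have := Int.gcd_dvd_right (d : ℤ) δ
    rwa [h] at this

lemma Filtered.mul (hv : RamifiedDegree θ v n) (hl : Level θ v n d N) (hQ : IsKey θ v d N δ Q)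
    {m m' : ℕ} {w w' : ℤ} {H H' : F[X]}
    (h : Filtered θ v N δ Q m w H) (h' : Filtered θ v N δ Q m' w' H') :
    Filtered θ v N δ Q (m + m') (w + w') (H * H') := by
  obtain ⟨A, hA, hAw, rfl⟩ := h
  obtain ⟨A', hA', hAw', rfl⟩ := h'
  rw [Finset.sum_mul_sum]
  refine Filtered.sum hv _ fun i hi => Filtered.sum hv _ fun j hj => ?_
  rw [Finset.mem_range] at hi hj
  have hdeg : (A i * A' j).degree < (2 * N : ℕ) := by
    rw [two_mul]
    exact degree_mul_lt (hA i) (natDegree_le_of_degree_lt (hA' j) (by omega))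
  have hball := hv.ball_mul (hAw i) (hAw' j)
  rw [← map_mul] at hball
  have h1 := (hl.filtered_of_ball hv hQ (two_le_quotient hl hQ) hdeg hball).mul_pow hv (i + j)
  have h2 : A i * Q ^ i * (A' j * Q ^ j) = A i * A' j * Q ^ (i + j) := by ring
  rw [h2]
  refine h1.mono hv (by omega) ?_
  push_cast; linarith

/-- In the `Q`-adic expansion of the minimal polynomial `P` of the generator, all terms have
formal degree at most that of the leading term. -/
lemma Level.filtered_minpoly (hv : RamifiedDegree θ v n) {P : F[X]} (hP : P.Monic)
    (hPn : P.natDegree = n) (hP0 : θ P = 0) (hl : Level θ v n d N) (hQ : IsKey θ v d N δ Q) :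
    Filtered θ v N δ Q d (d * δ) (P - Q ^ d) := by
  induction d using Nat.strong_induction_on generalizing N δ Q with
  | _ d ih =>
  have hq := gcd_mul_quotient d δ
  have hq2 := two_le_quotient hl hQ
  have hnext := hl.next hv hQ
  set e := Int.gcd d δ with he
  set q := d / e with hqdef
  have he0 : 0 < e := hnext.d_pos
  have hed : e < d := by nlinarith
  have hdeg : ∀ {k : ℕ} {G G' : F[X]}, G.Monic → G'.Monic → G.natDegree = k → G'.natDegree = k →
      (G - G').degree < k := by
    intro k G G' hG hG' hk hk'
    have h : G.degree = k := by rw [degree_eq_natDegree hG.ne_zero, hk]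
    rw [← h]
    refine degree_sub_lt_left ?_ hG.ne_zero ?_
    · rw [h, degree_eq_natDegree hG'.ne_zero, hk']
    · rw [hG.leadingCoeff, hG'.leadingCoeff]
  have hQpow : ∀ k : ℕ, InBall v (k * δ) (θ (Q ^ k)) := by
    intro k _
    rw [map_pow, hv.map_pow hQ.ne_zero, hQ.value]
  rcases Nat.lt_or_ge 1 e with h1 | h1
  · obtain ⟨Q₂, δ₂, hQ₂, hmin⟩ := hnext.exists_key hv h1
    have hQq : (Q ^ q).natDegree = q * N := by rw [hQ.monic.natDegree_pow, hQ.natDegree]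
    have hδ : δ₂ ≤ q * δ := by
      have := hmin (Q ^ q) (hQ.monic.pow q) hQq
      rwa [map_pow, hv.map_pow hQ.ne_zero, hQ.value] at this
    set B := Q₂ - Q ^ q with hB
    have hBF : Filtered θ v N δ Q q (q * δ) B := by
      refine hl.filtered_of_ball hv hQ le_rfl
        (hdeg hQ₂.monic (hQ.monic.pow q) hQ₂.natDegree hQq) ?_
      rw [map_sub]
      refine hv.ball_sub (fun _ => ?_) (hQpow q)
      rw [hQ₂.value]; exact hδ
    have hpow : ∀ l : ℕ, Filtered θ v N δ Q (l * q) (l * q * δ) (Q₂ ^ l - Q ^ (q * l)) := by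
      intro l
      induction l with
      | zero => simpa using Filtered.zero _ _
      | succ l ihl =>
        have : Q₂ ^ (l + 1) - Q ^ (q * (l + 1)) = ((Q₂ ^ l - Q ^ (q * l)) * Q ^ q
            + (Q₂ ^ l - Q ^ (q * l)) * B) + B * Q ^ (q * l) := by
          rw [hB]; ring
        rw [this]
        refine Filtered.add hv (Filtered.add hv ?_ ?_) ?_
        · refine (ihl.mul_pow hv q).mono hv (by linarith) (le_of_eq ?_)
          push_cast; ring
        · refine (ihl.mul hv hl hQ hBF).mono hv (by linarith) (le_of_eq ?_)
          push_cast; ring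
        · refine (hBF.mul_pow hv (q * l)).mono hv (by linarith) (le_of_eq ?_)
          push_cast; ring
    obtain ⟨A, hA, hAw, hsum⟩ := ih e hed hnext hQ₂
    have hsplit : P - Q ^ d = (P - Q₂ ^ e) + (Q₂ ^ e - Q ^ (q * e)) := by
      rw [← hq, mul_comm q e]; ring
    rw [hsplit, hsum]
    have hqz : (e : ℤ) * q = d := by exact_mod_cast hq
    refine Filtered.add hv (Filtered.sum hv _ fun l hlm => ?_) ?_
    · have hle := Finset.mem_range.1 hlm
      have hle' : (l : ℤ) + 1 ≤ e := by exact_mod_cast hle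
      have h2 : A l * Q₂ ^ l = A l * (Q₂ ^ l - Q ^ (q * l)) + A l * Q ^ (q * l) := by ring
      have hAF := hl.filtered_of_ball hv hQ le_rfl (hA l) (hAw l)
      have h3 : q + l * q ≤ d := by
        rw [← hq]
        calc q + l * q = (l + 1) * q := by ring
          _ ≤ e * q := Nat.mul_le_mul_right q hle
      have h4 : (e : ℤ) * δ₂ - l * δ₂ + l * q * δ ≤ d * δ := by
        rw [← hqz]; nlinarith
      rw [h2]
      refine Filtered.add hv ?_ ?_
      · exact (hAF.mul hv hl hQ (hpow l)).mono hv h3 h4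
      · refine (hAF.mul_pow hv (q * l)).mono hv (by linarith) ?_
        push_cast; linarith
    · refine (hpow e).mono hv hq.le ?_
      rw [hqz]
  · have he1 : e = 1 := by omega
    rw [he1, one_mul] at hq
    refine hl.filtered_of_ball hv hQ (by rw [← he, ← hqdef, hq]) ?_ ?_
    · refine hdeg hP (hQ.monic.pow d) (by rw [hPn, hl.mul_eq]) ?_
      rw [hQ.monic.natDegree_pow, hQ.natDegree]
    · rw [map_sub, hP0]
      exact hv.ball_sub (RamifiedDegree.ball_zero _) (hQpow d)

/-- A key polynomial can be improved to an approximate root of `P`, with the same degree. -/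
lemma Level.exists_key_approximate [CharZero F] (hv : RamifiedDegree θ v n) {P : F[X]}
    (hP : P.Monic) (hPn : P.natDegree = n) (hP0 : θ P = 0) (hl : Level θ v n (d + 1) N)
    (hQ : IsKey θ v (d + 1) N δ Q) :
    ∀ k ≤ N, ∃ Q' : F[X], IsKey θ v (d + 1) N δ Q' ∧
      (P - Q' ^ (d + 1)).degree < ((d + 1) * N - k : ℕ)
  | 0, _ => by
      refine ⟨Q, hQ, ?_⟩
      have h : P.degree = ((d + 1) * N : ℕ) := by
        rw [degree_eq_natDegree hP.ne_zero, hPn, hl.mul_eq]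
      rw [Nat.sub_zero, ← h]
      refine degree_sub_lt_left ?_ hP.ne_zero ?_
      · rw [h, degree_eq_natDegree (hQ.monic.pow _).ne_zero, hQ.monic.natDegree_pow, hQ.natDegree]
      · rw [hP.leadingCoeff, (hQ.monic.pow _).leadingCoeff]
  | k + 1, hk => by
      obtain ⟨G, hG, hGd⟩ := Level.exists_key_approximate hv hP hPn hP0 hl hQ k (by omega)
      have h5 : (d + 1) * N = d * N + N := by ring
      obtain ⟨A, hA, hAw, hsum⟩ := hl.filtered_minpoly hv hP hPn hP0 hG
      rw [Finset.sum_range_succ] at hsum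
      set S := ∑ l ∈ Finset.range d, A l * G ^ l with hS
      have hSd : S.degree < (d * N : ℕ) := by
        refine degree_sum_lt _ _ fun l hlm => ?_
        refine degree_lt_mono (degree_mul_lt (hA l) (b := l * N)
          (natDegree_pow_le_of_le l hG.natDegree.le)) ?_
        calc N + l * N = (l + 1) * N := by ring
          _ ≤ d * N := Nat.mul_le_mul_right N (Finset.mem_range.1 hlm)
      have hAd : (A d).degree < (N - k : ℕ) := by
        have h1 : (A d * G ^ d).degree < ((d + 1) * N - k : ℕ) := by
          have : A d * G ^ d = (P - G ^ (d + 1)) - S := by rw [hsum]; ring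
          rw [this]
          exact degree_sub_lt' hGd (degree_lt_mono hSd (by omega))
        rcases eq_or_ne (A d) 0 with h0 | h0
        · rw [h0, degree_zero]; exact WithBot.bot_lt_coe _
        · have hG0 : G ^ d ≠ 0 := (hG.monic.pow d).ne_zero
          have h2 := (natDegree_lt_iff_degree_lt (mul_ne_zero h0 hG0)).2 h1
          rw [natDegree_mul h0 hG0, hG.monic.natDegree_pow, hG.natDegree] at h2
          exact (natDegree_lt_iff_degree_lt h0).1 (by omega)
      have hd0 : ((d + 1 : ℕ) : F) ≠ 0 := by exact_mod_cast Nat.succ_ne_zero d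
      set B : F[X] := C ((d + 1 : ℕ) : F)⁻¹ * A d with hB
      have hAB : ((d + 1 : ℕ) : F[X]) * B = A d := by
        rw [hB, ← mul_assoc, ← C_eq_natCast, ← C_mul, mul_inv_cancel₀ hd0, C_1, one_mul]
      have hBd : ∀ {m : ℕ}, (A d).degree < m → B.degree < m := by
        intro m hm
        rw [hB, mul_comm]
        exact degree_mul_lt hm (b := 0) (by simp)
      have hBN : B.degree < G.degree := by
        rw [degree_eq_natDegree hG.monic.ne_zero, hG.natDegree]
        exact hBd (hA d)
      have hBball : InBall v (v (θ G) - 1) (θ B) := by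
        intro h0
        have hA0 : θ (A d) ≠ 0 := by
          intro h
          rw [hB, map_mul, h, mul_zero] at h0
          exact h0 rfl
        have h1 := hAw d hA0
        have h2 := hl.dvd B (hBd (hA d)) h0
        have h3 : v (θ B) ≤ δ := by
          rw [← hAB, map_mul, map_natCast] at h1 hA0
          rw [hv.map_mul _ _ (left_ne_zero_of_mul hA0) h0, hv.map_natCast _ (by omega)] at h1
          push_cast at h1
          linarith
        rw [hG.value]
        rcases h3.lt_or_eq with h | h
        · omega
        · rw [h] at h2; exact absurd h2 hG.not_dvd
      obtain ⟨hne, hval⟩ := hv.add_of_lt hG.ne_zero hBball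
      rw [← map_add] at hne hval
      refine ⟨G + B, ⟨hG.monic.add_of_left hBN, ?_, hne, hval.trans hG.value, hG.not_dvd⟩, ?_⟩
      · rw [natDegree_add_eq_left_of_degree_lt hBN, hG.natDegree]
      · have herr := degree_add_pow_sub_lt (Q := G) (N := N) hG.natDegree.le (by omega : k < N)
          (hBd hAd) d
        have h6 : P - (G + B) ^ (d + 1) = S
            - ((G + B) ^ (d + 1) - G ^ (d + 1) - (d + 1 : ℕ) * B * G ^ d) := by
          rw [hAB]; linear_combination hsum
        rw [h6]
        exact degree_sub_lt' (degree_lt_mono hSd (by omega)) (degree_lt_mono herr (by omega))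

end KeyPolynomials

section IntegralPolynomials

variable {R F L : Type*} [CommRing R] [Nontrivial R] [Field F] [Field L]
variable {ρ : R →+* F} {θ : F[X] →+* L} {v : L → ℤ} {n d N : ℕ}

/-- The approximate root of degree `N` is a key polynomial with coefficients in `R`. -/
lemma Level.exists_integral_key [CharZero F] (hR : ∀ m : ℕ, m ≠ 0 → IsUnit (m : R))
    (hv : RamifiedDegree θ v n) {P : R[X]} (hP : P.Monic) (hPn : P.natDegree = n)
    (hP0 : θ (P.map ρ) = 0) (hl : Level θ v n d N) (hd : 1 < d) :
    ∃ (G : R[X]) (δ : ℤ), G.Monic ∧ G.natDegree = N ∧ IsKey θ v d N δ (G.map ρ) := by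
  obtain ⟨d, rfl⟩ : ∃ k, d = k + 1 := ⟨d - 1, by omega⟩
  have h5 : (d + 1) * N - N = d * N := by rw [add_mul, one_mul, Nat.add_sub_cancel]
  obtain ⟨G, hG, hGN, hGd⟩ := exists_approximate_root hP (by rw [hPn, hl.mul_eq])
    (hR (d + 1) (by omega)) N le_rfl
  obtain ⟨Q, δ, hQ, -⟩ := hl.exists_key hv hd
  obtain ⟨Q', hQ', hQd⟩ := hl.exists_key_approximate hv (hP.map ρ)
    (by rw [hP.natDegree_map, hPn]) hP0 hQ N le_rfl
  rw [h5] at hGd hQd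
  have heq : Q' = G.map ρ := by
    refine approximate_root_unique hQ'.monic (hG.map ρ) hQ'.natDegree
      (by rw [hG.natDegree_map, hGN]) hQd ?_
    have : P.map ρ - G.map ρ ^ (d + 1) = (P - G ^ (d + 1)).map ρ := by
      rw [Polynomial.map_sub, Polynomial.map_pow]
    rw [this]
    exact degree_map_le.trans_lt hGd
  exact ⟨G, δ, hG, hGN, heq ▸ hQ'⟩

lemma exists_integral_expansion {G : R[X]} (hG : G.Monic) (hGN : G.natDegree = N) {m : ℕ}
    {H : R[X]} (hH : H.degree < (m * N : ℕ)) :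
    ∃ A : ℕ → R[X], (∀ l, (A l).degree < N) ∧ (∀ l, ((A l).map ρ).degree < N) ∧
      H.map ρ = ∑ l ∈ Finset.range m, (A l).map ρ * G.map ρ ^ l := by
  obtain ⟨A, hA, rfl⟩ := exists_adic_expansion hG hGN m H hH
  refine ⟨A, hA, fun l => degree_map_le.trans_lt (hA l), ?_⟩
  simp only [Polynomial.map_sum, Polynomial.map_mul, Polynomial.map_pow]

lemma exists_ne_zero_of_sum {A : ℕ → F[X]} {Q : F[X]} {m : ℕ}
    (h : θ (∑ l ∈ Finset.range m, A l * Q ^ l) ≠ 0) : ∃ l < m, θ (A l) ≠ 0 := by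
  by_contra hcon
  push Not at hcon
  refine h ?_
  rw [map_sum]
  exact Finset.sum_eq_zero fun l hlm => by
    rw [map_mul, hcon l (Finset.mem_range.1 hlm), zero_mul]

/-- Among polynomials over `R` of degree less than `N`, `v₁` is the least value in its class
modulo `n`. -/
def IsLeastValue (ρ : R →+* F) (θ : F[X] →+* L) (v : L → ℤ) (n N : ℕ) (v₁ : ℤ) : Prop :=
  ∀ H : R[X], H.degree < N → θ (H.map ρ) ≠ 0 → (n : ℤ) ∣ v (θ (H.map ρ)) - v₁ →
    v₁ ≤ v (θ (H.map ρ))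

lemma Level.isLeastValue_of_linear [CharZero F] (hR : ∀ m : ℕ, m ≠ 0 → IsUnit (m : R))
    (hv : RamifiedDegree θ v n) {P : R[X]} (hP : P.Monic) (hPn : P.natDegree = n)
    (hP0 : θ (P.map ρ) = 0) {G₁ : F[X]} (hG₁ : G₁.degree < (2 : ℕ)) (hG0 : θ G₁ ≠ 0)
    (hl : Level θ v n d N) (hN : 2 ≤ N) (hmin : IsLeastValue ρ θ v n N (v (θ G₁))) :
    IsLeastValue ρ θ v n n (v (θ G₁)) := by
  induction d using Nat.strong_induction_on generalizing N with
  | _ d ih =>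
  rcases Nat.lt_or_ge 1 d with hd | hd
  · obtain ⟨G, δ, hG, hGN, hkey⟩ := hl.exists_integral_key hR hv hP hPn hP0 hd
    have hnext := hl.next hv hkey
    have hq := gcd_mul_quotient d δ
    have hq2 := two_le_quotient hl hkey
    refine ih _ ?_ hnext (by nlinarith) ?_
    · have := hnext.d_pos
      nlinarith
    · intro H hH h0 hdvd
      obtain ⟨A, hA, hA', hsum⟩ := exists_integral_expansion (ρ := ρ) hG hGN hH
      rw [hsum] at h0 hdvd ⊢
      obtain ⟨-, l, hlq, hl0, hval, -⟩ := hl.sum_value hv hkey le_rfl hA'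
        (exists_ne_zero_of_sum h0)
      have hdn : (d : ℤ) ∣ n := ⟨N, by exact_mod_cast hl.mul_eq.symm⟩
      have h1 : (d : ℤ) ∣ l * δ := by
        have h2 := hdn.trans hdvd
        have h3 := hl.dvd G₁ (degree_lt_mono hG₁ hN) hG0
        have h4 := hl.dvd _ (hA' l) hl0
        rw [hval] at h2
        have h5 := dvd_sub (dvd_add h2 h3) h4
        have h6 : v (θ ((A l).map ρ)) + l * δ - v (θ G₁) + v (θ G₁) - v (θ ((A l).map ρ))
            = l * δ := by ring
        rwa [h6] at h5
      have h2 := dvd_of_dvd_mul_quotient hl.d_pos h1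
      have h3 : l = 0 := Nat.eq_zero_of_dvd_of_lt (Int.natCast_dvd_natCast.1 h2) hlq
      subst h3
      rw [hval] at hdvd ⊢
      simp only [Nat.cast_zero, zero_mul, add_zero] at hdvd ⊢
      exact hmin _ (hA 0) hl0 hdvd
  · have h1 : d = 1 := by have := hl.d_pos; omega
    have h2 := hl.mul_eq
    rw [h1, one_mul] at h2
    rwa [← h2] at hmin ⊢

/-- If every nonnegative integer is the degree of some polynomial over `R`, then some translate
of the generator has degree less than `n`. -/
theorem exists_translate_lt [CharZero F] (hR : ∀ m : ℕ, m ≠ 0 → IsUnit (m : R))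
    (hv : RamifiedDegree θ v n) {P : R[X]} (hP : P.Monic) (hPn : P.natDegree = n)
    (hP0 : θ (P.map ρ) = 0) (hn : 2 ≤ n)
    (hnonneg : ∀ a : R, θ (C (ρ a)) ≠ 0 → 0 ≤ v (θ (C (ρ a))))
    (hsurj : ∀ k : ℕ, ∃ H : R[X], H.degree < n ∧ θ (H.map ρ) ≠ 0 ∧ v (θ (H.map ρ)) = k) :
    ∃ c : R, θ (X + C (ρ c)) ≠ 0 ∧ v (θ (X + C (ρ c))) < n := by
  have hl := Level.initial hv (by omega)
  obtain ⟨G, δ, hG, hGN, hkey⟩ := hl.exists_integral_key hR hv hP hPn hP0 (by omega)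
  have hGX : G = X + C (G.coeff 0) := hG.eq_X_add_C hGN
  have hGmap : G.map ρ = X + C (ρ (G.coeff 0)) := by
    conv_lhs => rw [hGX]
    simp
  refine ⟨G.coeff 0, ?_⟩
  rw [← hGmap]
  refine ⟨hkey.ne_zero, ?_⟩
  have hq := gcd_mul_quotient n δ
  have hq2 := two_le_quotient hl hkey
  have hnext := hl.next hv hkey
  have hG2 : (G.map ρ).degree < (2 : ℕ) := by
    rw [degree_eq_natDegree hkey.monic.ne_zero, hkey.natDegree]; norm_num
  have hmin : IsLeastValue ρ θ v n n (v (θ (G.map ρ))) := by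
    refine hnext.isLeastValue_of_linear hR hv hP hPn hP0 hG2 hkey.ne_zero (by omega) ?_
    intro H hH h0 hdvd
    obtain ⟨A, hA, hA', hsum⟩ := exists_integral_expansion (ρ := ρ) hG hGN hH
    rw [hsum] at h0 hdvd ⊢
    obtain ⟨-, l, hlq, hl0, hval, -⟩ := hl.sum_value hv hkey le_rfl hA'
      (exists_ne_zero_of_sum h0)
    have h1 : (n : ℤ) ∣ ((l : ℤ) - 1) * δ := by
      have h4 := dvd_sub hdvd (hl.dvd _ (hA' l) hl0)
      rw [hval, hkey.value] at h4
      have h6 : v (θ ((A l).map ρ)) + l * δ - δ - v (θ ((A l).map ρ)) = (l - 1) * δ := by ring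
      rwa [h6] at h4
    have h2 := dvd_of_dvd_mul_quotient hl.d_pos h1
    have h3 := Int.eq_zero_of_abs_lt_dvd h2 (by rw [abs_lt]; constructor <;> omega)
    have h4 : l = 1 := by omega
    subst h4
    have h5 : (A 1).map ρ = C (ρ ((A 1).coeff 0)) := by
      have h7 := natDegree_le_of_degree_lt (hA 1) (b := 0) (by omega)
      conv_lhs => rw [eq_C_of_natDegree_le_zero h7]
      simp
    rw [h5] at hl0 hval
    rw [hval, hkey.value]
    have := hnonneg _ hl0
    push_cast
    linarith
  by_contra hcon
  rw [not_lt] at hcon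
  obtain ⟨k, hk⟩ := Int.eq_ofNat_of_zero_le (sub_nonneg.2 hcon)
  obtain ⟨H, hH, h0, hHk⟩ := hsurj k
  have h1 : v (θ (H.map ρ)) = v (θ (G.map ρ)) - n := by omega
  have := hmin H hH h0 ⟨-1, by rw [h1]; ring⟩
  omega

end IntegralPolynomials

section RatFuncDegree

variable {K : Type*} [Field K]

local notation "ι" => algebraMap K[X] (RatFunc K)

lemma ratFunc_intDegree_algebraMap (p : K[X]) :
    RatFunc.intDegree (ι p) = p.natDegree := RatFunc.intDegree_polynomial

lemma ratFunc_algebraMap_ne_zero {p : K[X]} (hp : p ≠ 0) : ι p ≠ 0 :=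
  RatFunc.algebraMap_ne_zero hp

lemma intDegree_add_eq_of_lt {x y : RatFunc K} (hx : x ≠ 0) (hy : y ≠ 0)
    (h : y.intDegree < x.intDegree) : x + y ≠ 0 ∧ (x + y).intDegree = x.intDegree := by
  have h0 : x + y ≠ 0 := by
    intro h0
    have : y = -x := by linear_combination h0
    rw [this, RatFunc.intDegree_neg] at h
    exact lt_irrefl _ h
  refine ⟨h0, le_antisymm ?_ ?_⟩
  · exact (RatFunc.intDegree_add_le hy h0).trans (max_le le_rfl h.le)
  · have h1 : (x + y) + -y = x := by ring
    have := RatFunc.intDegree_add_le (x := x + y) (y := -y) (neg_ne_zero.2 hy) (by rwa [h1])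
    rw [h1, RatFunc.intDegree_neg] at this
    rcases le_max_iff.1 this with h2 | h2
    · exact h2
    · omega

lemma intDegree_sum_of_distinct {κ : Type*} (s : Finset κ) (x : κ → RatFunc K)
    (hdist : ∀ i ∈ s, ∀ j ∈ s, x i ≠ 0 → x j ≠ 0 → (x i).intDegree = (x j).intDegree → i = j) :
    (∀ j ∈ s, x j = 0) ∨ (∑ i ∈ s, x i ≠ 0 ∧
      (∃ i ∈ s, x i ≠ 0 ∧ (∑ i ∈ s, x i).intDegree = (x i).intDegree) ∧
      ∀ j ∈ s, x j ≠ 0 → (x j).intDegree ≤ (∑ i ∈ s, x i).intDegree) := by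
  classical
  induction s using Finset.induction_on with
  | empty => simp
  | insert a s ha ih =>
    rw [Finset.sum_insert ha]
    by_cases hxa : x a = 0
    · rcases ih (fun i hi j hj => hdist i (Finset.mem_insert_of_mem hi) j
        (Finset.mem_insert_of_mem hj)) with h | ⟨h0, ⟨i, hi, hi0, hiv⟩, hle⟩
      · left
        simpa [hxa] using h
      · right
        rw [hxa, zero_add]
        refine ⟨h0, ⟨i, Finset.mem_insert_of_mem hi, hi0, hiv⟩, ?_⟩
        intro j hj hj0
        rcases Finset.mem_insert.1 hj with rfl | hj
        · exact absurd hxa hj0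
        · exact hle j hj hj0
    · right
      rcases ih (fun i hi j hj => hdist i (Finset.mem_insert_of_mem hi) j
        (Finset.mem_insert_of_mem hj)) with h | ⟨h0, ⟨i, hi, hi0, hiv⟩, hle⟩
      · rw [Finset.sum_eq_zero h, add_zero]
        refine ⟨hxa, ⟨a, Finset.mem_insert_self _ _, hxa, rfl⟩, ?_⟩
        intro j hj hj0
        rcases Finset.mem_insert.1 hj with rfl | hj
        · exact le_rfl
        · exact absurd (h j hj) hj0
      · have hne : (x a).intDegree ≠ (x i).intDegree := fun h => ha <| by
          rw [hdist a (Finset.mem_insert_self _ _) i (Finset.mem_insert_of_mem hi) hxa hi0 h]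
          exact hi
        rcases lt_or_gt_of_ne hne with hlt | hgt
        · obtain ⟨h1, h2⟩ := intDegree_add_eq_of_lt h0 hxa (by rw [hiv]; exact hlt)
          rw [add_comm] at h1 h2
          refine ⟨h1, ⟨i, Finset.mem_insert_of_mem hi, hi0, h2.trans hiv⟩, ?_⟩
          intro j hj hj0
          rw [h2]
          rcases Finset.mem_insert.1 hj with rfl | hj
          · rw [hiv]; exact hlt.le
          · exact hle j hj hj0
        · obtain ⟨h1, h2⟩ := intDegree_add_eq_of_lt hxa h0 (by rw [hiv]; exact hgt)
          refine ⟨h1, ⟨a, Finset.mem_insert_self _ _, hxa, h2⟩, ?_⟩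
          intro j hj hj0
          rw [h2]
          rcases Finset.mem_insert.1 hj with rfl | hj
          · exact le_rfl
          · exact (hle j hj hj0).trans (by rw [hiv]; exact hgt.le)

lemma exists_intDegree_sum_le {κ : Type*} (s : Finset κ) (x : κ → RatFunc K)
    (h : ∑ i ∈ s, x i ≠ 0) :
    ∃ i ∈ s, x i ≠ 0 ∧ (∑ i ∈ s, x i).intDegree ≤ (x i).intDegree := by
  classical
  induction s using Finset.induction_on with
  | empty => simp at h
  | insert a s ha ih =>
    rw [Finset.sum_insert ha] at h ⊢
    by_cases hs : ∑ i ∈ s, x i = 0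
    · rw [hs, add_zero] at h ⊢
      exact ⟨a, Finset.mem_insert_self _ _, h, le_rfl⟩
    · obtain ⟨i, hi, hi0, hle⟩ := ih hs
      by_cases hxa : x a = 0
      · rw [hxa, zero_add]
        exact ⟨i, Finset.mem_insert_of_mem hi, hi0, hle⟩
      · rcases le_max_iff.1 (RatFunc.intDegree_add_le hs h) with h1 | h1
        · exact ⟨a, Finset.mem_insert_self _ _, hxa, h1⟩
        · exact ⟨i, Finset.mem_insert_of_mem hi, hi0, h1.trans hle⟩

lemma exists_intDegree_sub_C_mul_lt {x y : RatFunc K} (hx : x ≠ 0) (hy : y ≠ 0)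
    (hxy : x.intDegree = y.intDegree) :
    ∃ c : K, x - RatFunc.C c * y ≠ 0 →
      (x - RatFunc.C c * y).intDegree < x.intDegree := by
  obtain ⟨p, q, hq, rfl⟩ := IsFractionRing.div_surjective (A := K[X]) x
  obtain ⟨r, s, hs, rfl⟩ := IsFractionRing.div_surjective (A := K[X]) y
  have hq0 : q ≠ 0 := nonZeroDivisors.ne_zero hq
  have hs0 : s ≠ 0 := nonZeroDivisors.ne_zero hs
  have hp0 : p ≠ 0 := by rintro rfl; simp at hx
  have hr0 : r ≠ 0 := by rintro rfl; simp at hy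
  have iq := ratFunc_algebraMap_ne_zero hq0
  have is := ratFunc_algebraMap_ne_zero hs0
  have ip := ratFunc_algebraMap_ne_zero hp0
  have ir := ratFunc_algebraMap_ne_zero hr0
  rw [RatFunc.intDegree_div ip iq, RatFunc.intDegree_div ir is] at hxy
  simp only [ratFunc_intDegree_algebraMap] at hxy
  set c : K := p.leadingCoeff * s.leadingCoeff / (q.leadingCoeff * r.leadingCoeff) with hc
  have lq := leadingCoeff_ne_zero.2 hq0
  have ls := leadingCoeff_ne_zero.2 hs0
  have lp := leadingCoeff_ne_zero.2 hp0
  have lr := leadingCoeff_ne_zero.2 hr0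
  have hc0 : c ≠ 0 := by rw [hc]; positivity
  refine ⟨c, fun h => ?_⟩
  have key : ι p / ι q - RatFunc.C c * (ι r / ι s) = ι (p * s - C c * (r * q)) / ι (q * s) := by
    rw [← RatFunc.algebraMap_C]
    simp only [map_sub, map_mul]
    field_simp
  rw [key] at h ⊢
  have hnum : p * s - C c * (r * q) ≠ 0 := by
    intro h0; rw [h0] at h; simp at h
  rw [RatFunc.intDegree_div (ratFunc_algebraMap_ne_zero hnum)
    (ratFunc_algebraMap_ne_zero (mul_ne_zero hq0 hs0)), RatFunc.intDegree_div ip iq]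
  simp only [ratFunc_intDegree_algebraMap]
  have hdeg : (p * s - C c * (r * q)).degree < (p * s).degree := by
    refine degree_sub_lt_left ?_ (mul_ne_zero hp0 hs0) ?_
    · rw [degree_C_mul hc0, degree_eq_natDegree (mul_ne_zero hp0 hs0),
        degree_eq_natDegree (mul_ne_zero hr0 hq0), natDegree_mul hp0 hs0, natDegree_mul hr0 hq0]
      norm_cast
      omega
    · simp only [leadingCoeff_mul, leadingCoeff_C, hc]
      field_simp
  have := natDegree_lt_natDegree hnum hdeg
  rw [natDegree_mul hp0 hs0] at this
  rw [natDegree_mul hq0 hs0]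
  push_cast
  omega

end RatFuncDegree

section Substitution

variable {K : Type*} [Field K]

local notation "ι" => algebraMap K[X] (RatFunc K)

lemma comp_ne_zero_of_pos {f : K[X]} (hf : 0 < f.natDegree) {p : K[X]} (hp : p ≠ 0) :
    p.comp f ≠ 0 := by
  rw [Ne, comp_eq_zero_iff]
  rintro (h | ⟨-, h⟩)
  · exact hp h
  · rw [h, natDegree_C] at hf
    exact lt_irrefl _ hf

lemma compRingHom_injective {f : K[X]} (hf : 0 < f.natDegree) :
    Function.Injective (compRingHom f) := by
  rw [injective_iff_map_eq_zero]
  intro p hp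
  by_contra h
  exact comp_ne_zero_of_pos hf h hp

/-- Substitution `X ↦ f` on rational functions, for a nonconstant polynomial `f`. -/
noncomputable def ratFuncSubst (f : K[X]) (hf : 0 < f.natDegree) : RatFunc K →+* RatFunc K :=
  RatFunc.mapRingHom (compRingHom f) (nonZeroDivisors_le_comap_nonZeroDivisors_of_injective _
    (compRingHom_injective hf))

variable {f : K[X]} (hf : 0 < f.natDegree)

lemma ratFuncSubst_algebraMap (p : K[X]) :
    ratFuncSubst f hf (ι p) = ι (p.comp f) := by
  have := RatFunc.map_apply_div (K := K) (compRingHom f)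
    (nonZeroDivisors_le_comap_nonZeroDivisors_of_injective _ (compRingHom_injective hf)) p 1
  simpa [ratFuncSubst, RatFunc.coe_mapRingHom_eq_coe_map] using this

lemma ratFuncSubst_C (c : K) : ratFuncSubst f hf (RatFunc.C c) = RatFunc.C c := by
  rw [← RatFunc.algebraMap_C, ratFuncSubst_algebraMap, C_comp]

lemma intDegree_ratFuncSubst (x : RatFunc K) :
    (ratFuncSubst f hf x).intDegree = f.natDegree * x.intDegree := by
  by_cases hx : x = 0
  · simp [hx]
  obtain ⟨p, q, hq, rfl⟩ := IsFractionRing.div_surjective (A := K[X]) x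
  have hq0 : q ≠ 0 := nonZeroDivisors.ne_zero hq
  have hp0 : p ≠ 0 := by rintro rfl; simp at hx
  rw [map_div₀, ratFuncSubst_algebraMap, ratFuncSubst_algebraMap,
    RatFunc.intDegree_div (ratFunc_algebraMap_ne_zero (comp_ne_zero_of_pos hf hp0))
      (ratFunc_algebraMap_ne_zero (comp_ne_zero_of_pos hf hq0)),
    RatFunc.intDegree_div (ratFunc_algebraMap_ne_zero hp0) (ratFunc_algebraMap_ne_zero hq0)]
  simp only [ratFunc_intDegree_algebraMap, natDegree_comp]
  push_cast
  ring

/-- The monomials `X ^ j` with `j < deg f` are independent over the field `K(f)`, with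
degrees separating their multiples. -/
lemma subst_combination (a : Fin f.natDegree → RatFunc K) (ha : a ≠ 0) :
    ∑ j, ratFuncSubst f hf (a j) * ι (X ^ (j : ℕ)) ≠ 0 ∧
    ∀ j, a j ≠ 0 → (f.natDegree : ℤ) * (a j).intDegree + j ≤
      (∑ j, ratFuncSubst f hf (a j) * ι (X ^ (j : ℕ))).intDegree := by
  have hX : ∀ j : ℕ, ι (X ^ j) ≠ 0 := fun j =>
    ratFunc_algebraMap_ne_zero (pow_ne_zero _ X_ne_zero)
  have hz : ∀ j : Fin f.natDegree,
      ratFuncSubst f hf (a j) * ι (X ^ (j : ℕ)) ≠ 0 ↔ a j ≠ 0 := fun j => by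
    rw [mul_ne_zero_iff, _root_.map_ne_zero]
    exact and_iff_left (hX j)
  have hd : ∀ j : Fin f.natDegree, a j ≠ 0 →
      (ratFuncSubst f hf (a j) * ι (X ^ (j : ℕ))).intDegree =
        f.natDegree * (a j).intDegree + j := fun j hj => by
    rw [RatFunc.intDegree_mul ((_root_.map_ne_zero _).2 hj) (hX j), intDegree_ratFuncSubst,
      ratFunc_intDegree_algebraMap, natDegree_X_pow]
  have hdist : ∀ i ∈ Finset.univ, ∀ j ∈ Finset.univ,
      ratFuncSubst f hf (a i) * ι (X ^ (i : ℕ)) ≠ 0 →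
      ratFuncSubst f hf (a j) * ι (X ^ (j : ℕ)) ≠ 0 →
      (ratFuncSubst f hf (a i) * ι (X ^ (i : ℕ))).intDegree =
        (ratFuncSubst f hf (a j) * ι (X ^ (j : ℕ))).intDegree → i = j := by
    intro i _ j _ hi hj hij
    rw [hd i ((hz i).1 hi), hd j ((hz j).1 hj)] at hij
    ext
    have hi' := i.2
    have hj' := j.2
    have h1 : ((f.natDegree : ℤ) * (a i).intDegree + i) % f.natDegree = i := by
      rw [Int.mul_add_emod_self_left]
      exact Int.emod_eq_of_lt (by positivity) (by exact_mod_cast hi')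
    have h2 : ((f.natDegree : ℤ) * (a j).intDegree + j) % f.natDegree = j := by
      rw [Int.mul_add_emod_self_left]
      exact Int.emod_eq_of_lt (by positivity) (by exact_mod_cast hj')
    rw [hij, h2] at h1
    exact_mod_cast h1.symm
  rcases intDegree_sum_of_distinct Finset.univ
    (fun j : Fin f.natDegree => ratFuncSubst f hf (a j) * ι (X ^ (j : ℕ))) hdist with h | ⟨h0, -, hle⟩
  · refine absurd (_root_.funext fun j => ?_) ha
    by_contra hj
    exact (hz j).2 hj (h j (Finset.mem_univ j))
  · refine ⟨h0, fun j hj => ?_⟩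
    rw [← hd j hj]
    exact hle j (Finset.mem_univ j) ((hz j).2 hj)

lemma subst_combination_injective (hf : 0 < f.natDegree) {a b : Fin f.natDegree → K[X]}
    (h : ∑ j, (a j).comp f * X ^ (j : ℕ) = ∑ j, (b j).comp f * X ^ (j : ℕ)) : a = b := by
  by_contra hab
  refine (subst_combination hf (fun j => ι (a j - b j)) fun h0 => hab ?_).1 ?_
  · funext j
    have := congrFun h0 j
    simpa [sub_eq_zero] using this
  · simp only [ratFuncSubst_algebraMap, ← map_mul, ← map_sum, sub_comp, sub_mul,
      Finset.sum_sub_distrib, h, sub_self, map_zero]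

/-- Every polynomial is a combination of `X ^ j`, `j < deg f`, with coefficients in `K[f]`. -/
lemma exists_subst_combination (hf : 0 < f.natDegree) (u : K[X]) :
    ∃ a : Fin f.natDegree → K[X], ∑ j, (a j).comp f * X ^ (j : ℕ) = u := by
  induction hN : u.natDegree using Nat.strong_induction_on generalizing u with
  | _ N ih =>
  have hf0 : f ≠ 0 := by rintro rfl; simp at hf
  have hlow : ∀ r : K[X], r.degree < f.natDegree →
      ∑ j : Fin f.natDegree, (C (r.coeff j)).comp f * X ^ (j : ℕ) = r := fun r hr => by
    simp only [C_comp]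
    rw [Fin.sum_univ_eq_sum_range (fun j => C (r.coeff j) * X ^ j) f.natDegree]
    exact (as_sum_range_C_mul_X_pow' r (by
      by_cases hr0 : r = 0
      · simpa [hr0] using hf
      · exact (natDegree_lt_iff_degree_lt hr0).2 hr)).symm
  by_cases hu : u.natDegree < f.natDegree
  · exact ⟨fun j => C (u.coeff j), hlow u ((degree_le_natDegree).trans_lt (by exact_mod_cast hu))⟩
  · obtain ⟨a, ha⟩ := ih (u / f).natDegree (by
      rw [← hN]
      refine natDegree_lt_natDegree ?_ (degree_div_lt ?_ (natDegree_pos_iff_degree_pos.1 hf))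
      · rw [Ne, Polynomial.div_eq_zero_iff hf0]
        intro h
        by_cases hu0 : u = 0
        · exact hu (by simpa [hu0] using hf)
        · exact hu (natDegree_lt_natDegree hu0 h)
      · rintro rfl; exact hu (by simpa using hf)) (u / f) rfl
    refine ⟨fun j => X * a j + C ((u % f).coeff j), ?_⟩
    simp only [add_comp, mul_comp, X_comp, add_mul, Finset.sum_add_distrib, mul_assoc,
      ← Finset.mul_sum, ha]
    rw [hlow, EuclideanDomain.div_add_mod]
    rw [← degree_eq_natDegree hf0]
    exact EuclideanDomain.mod_lt u hf0

end Substitution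

section Evaluation

variable {K : Type*} [Field K]

local notation "ι" => algebraMap K[X] (RatFunc K)

/-- Evaluation of a two-variable polynomial at the pair `(f, g)`. -/
noncomputable def evalPair (f g : K[X]) : K[X][X] →+* K[X] := eval₂RingHom (compRingHom f) g

/-- Evaluation at `(f, g)` of polynomials in the second variable over the rational functions. -/
noncomputable def ratEvalPair (f g : K[X]) (hf : 0 < f.natDegree) :
    (RatFunc K)[X] →+* RatFunc K :=
  eval₂RingHom (ratFuncSubst f hf) (ι g)

variable {f : K[X]} (g : K[X]) (hf : 0 < f.natDegree)

lemma evalPair_C (a : K[X]) : evalPair f g (C a) = a.comp f := by simp [evalPair]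

lemma evalPair_X : evalPair f g X = g := by simp [evalPair]

lemma ratEvalPair_C (a : RatFunc K) : ratEvalPair f g hf (C a) = ratFuncSubst f hf a := by
  simp [ratEvalPair]

lemma ratEvalPair_X : ratEvalPair f g hf X = ι g := by simp [ratEvalPair]

lemma ratEvalPair_map (H : K[X][X]) : ratEvalPair f g hf (H.map ι) = ι (evalPair f g H) := by
  have : (ratEvalPair f g hf).comp (mapRingHom ι) = (ι : K[X] →+* RatFunc K).comp (evalPair f g) := by
    refine Polynomial.ringHom_ext' (RingHom.ext fun a => ?_) ?_
    · simp [ratEvalPair_C, evalPair_C, ratFuncSubst_algebraMap]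
    · simp [ratEvalPair_X, evalPair_X]
  exact RingHom.congr_fun this H

lemma evalPair_eq_sum {H : K[X][X]} (hf : 0 < f.natDegree) (hH : H.degree < f.natDegree) :
    evalPair f g H = ∑ i : Fin f.natDegree, (H.coeff i).comp f * g ^ (i : ℕ) := by
  have hH' : H.natDegree < f.natDegree := by
    by_cases h0 : H = 0
    · simpa [h0] using hf
    · exact (natDegree_lt_iff_degree_lt h0).2 hH
  conv_lhs => rw [as_sum_range_C_mul_X_pow' H hH']
  rw [Fin.sum_univ_eq_sum_range (fun i => (H.coeff i).comp f * g ^ i) f.natDegree]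
  simp [map_sum, evalPair_C, evalPair_X]

lemma ratEvalPair_eq_sum {H : (RatFunc K)[X]} (hH : H.degree < f.natDegree) :
    ratEvalPair f g hf H =
      ∑ i : Fin f.natDegree, ratFuncSubst f hf (H.coeff i) * ι g ^ (i : ℕ) := by
  have hH' : H.natDegree < f.natDegree := by
    by_cases h0 : H = 0
    · simpa [h0] using hf
    · exact (natDegree_lt_iff_degree_lt h0).2 hH
  conv_lhs => rw [as_sum_range_C_mul_X_pow' H hH']
  rw [Fin.sum_univ_eq_sum_range (fun i => ratFuncSubst f hf (H.coeff i) * ι g ^ i) f.natDegree]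
  simp [map_sum, ratEvalPair_C, ratEvalPair_X]

/-- The characteristic polynomial of multiplication by `g` on `K[X]` over `K[f]` is a monic
relation of degree `deg f` between `f` and `g`. -/
lemma exists_monic_relation (hf : 0 < f.natDegree) :
    ∃ P : K[X][X], P.Monic ∧ P.natDegree = f.natDegree ∧ evalPair f g P = 0 := by
  choose M hM using fun i : Fin f.natDegree => exists_subst_combination hf (X ^ (i : ℕ) * g)
  let A : Matrix (Fin f.natDegree) (Fin f.natDegree) K[X] := Matrix.of M
  refine ⟨A.charpoly, A.charpoly_monic, by simp, ?_⟩
  have h1 : evalPair f g A.charpoly = (A.map (compRingHom f)).charpoly.eval g := by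
    rw [Matrix.charpoly_map, eval_map]
    rfl
  rw [h1, Matrix.eval_charpoly]
  refine Matrix.exists_mulVec_eq_zero_iff.1 ⟨fun i => X ^ (i : ℕ), fun h => ?_, ?_⟩
  · exact pow_ne_zero _ X_ne_zero (congrFun h ⟨0, hf⟩)
  · rw [Matrix.sub_mulVec, sub_eq_zero]
    funext i
    have := hM i
    simp only [Matrix.scalar_apply, Matrix.mulVec_diagonal]
    simp only [Matrix.mulVec, dotProduct, Matrix.map_apply, coe_compRingHom_apply, A, Matrix.of_apply]
    rw [this, mul_comm]

lemma exists_degree_lt_evalPair_eq {P : K[X][X]} (hP : P.Monic) (hPn : P.natDegree = f.natDegree)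
    (hP0 : evalPair f g P = 0) (H : K[X][X]) :
    ∃ H' : K[X][X], H'.degree < f.natDegree ∧ evalPair f g H' = evalPair f g H := by
  refine ⟨H %ₘ P, ?_, ?_⟩
  · rw [← hPn, ← degree_eq_natDegree hP.ne_zero]
    exact degree_modByMonic_lt H hP
  · conv_rhs => rw [← modByMonic_add_div H P, map_add, map_mul, hP0, zero_mul, add_zero]

/-- If `f` and `g` generate `K[X]`, the powers of `g` and the powers of `X` are related by
mutually inverse matrices over `K[f]`. -/
lemma exists_inverse_base_change (hf : 0 < f.natDegree)
    (hgen : Function.Surjective (evalPair f g)) :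
    ∃ T S : Matrix (Fin f.natDegree) (Fin f.natDegree) K[X], T * S = 1 ∧
      ∀ i, ∑ j, (T i j).comp f * X ^ (j : ℕ) = g ^ (i : ℕ) := by
  obtain ⟨P, hP, hPn, hP0⟩ := exists_monic_relation g hf
  choose T hT using fun i : Fin f.natDegree => exists_subst_combination hf (g ^ (i : ℕ))
  have hS : ∀ j : Fin f.natDegree, ∃ s : Fin f.natDegree → K[X],
      ∑ i, (s i).comp f * g ^ (i : ℕ) = X ^ (j : ℕ) := fun j => by
    obtain ⟨H, hH⟩ := hgen (X ^ (j : ℕ))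
    obtain ⟨H', hd, he⟩ := exists_degree_lt_evalPair_eq g hP hPn hP0 H
    exact ⟨fun i => H'.coeff i, by rw [← evalPair_eq_sum g hf hd, he, hH]⟩
  choose S hS using hS
  refine ⟨Matrix.of T, Matrix.of S, mul_eq_one_comm.1 ?_, hT⟩
  ext1 j k
  refine congrFun (subst_combination_injective hf (a := (Matrix.of S * Matrix.of T) j)
    (b := (1 : Matrix _ _ K[X]) j) ?_) k
  have h1 : ∑ k, ((1 : Matrix (Fin f.natDegree) (Fin f.natDegree) K[X]) j k).comp f * X ^ (k : ℕ) =
      X ^ (j : ℕ) := by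
    rw [Finset.sum_eq_single j]
    · simp
    · intro b _ hb
      rw [Matrix.one_apply_ne hb.symm]
      simp
    · simp
  rw [h1, ← hS j]
  simp only [Matrix.mul_apply, Matrix.of_apply, ← coe_compRingHom_apply, map_sum, map_mul,
    Finset.sum_mul]
  rw [Finset.sum_comm]
  refine Finset.sum_congr rfl fun i _ => ?_
  rw [← hT i, Finset.mul_sum]
  simp only [coe_compRingHom_apply, mul_assoc]

lemma natDegree_le_sum_natDegree {κ : Type*} [Fintype κ] (S : Matrix κ κ K[X]) (i j : κ) :
    (S i j).natDegree ≤ ∑ i, ∑ j, (S i j).natDegree :=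
  (Finset.single_le_sum (f := fun j => (S i j).natDegree) (fun _ _ => Nat.zero_le _)
    (Finset.mem_univ j)).trans
  (Finset.single_le_sum (f := fun i => ∑ j, (S i j).natDegree) (fun _ _ => Nat.zero_le _)
    (Finset.mem_univ i))

lemma ratEvalPair_ne_zero_and_le (hgen : Function.Surjective (evalPair f g)) :
    ∃ B : ℕ, ∀ H : (RatFunc K)[X], H.degree < f.natDegree → ∀ i : Fin f.natDegree,
      H.coeff i ≠ 0 → ratEvalPair f g hf H ≠ 0 ∧
        (f.natDegree : ℤ) * ((H.coeff i).intDegree - B) ≤ (ratEvalPair f g hf H).intDegree := by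
  obtain ⟨T, S, hTS, hT⟩ := exists_inverse_base_change g hf hgen
  refine ⟨∑ i, ∑ j, (S i j).natDegree, fun H hH i hi => ?_⟩
  let c : Fin f.natDegree → RatFunc K := fun k => H.coeff k
  let TF := T.map ι
  let SF := S.map ι
  have hTSF : TF * SF = 1 := by
    rw [← Matrix.map_mul, hTS]
    exact Matrix.map_one _ (map_zero _) (map_one _)
  let a := Matrix.vecMul c TF
  have hc : Matrix.vecMul a SF = c := by
    rw [Matrix.vecMul_vecMul, hTSF, Matrix.vecMul_one]
  have hval : ratEvalPair f g hf H = ∑ j, ratFuncSubst f hf (a j) * ι (X ^ (j : ℕ)) := by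
    rw [ratEvalPair_eq_sum g hf hH]
    simp only [a, Matrix.vecMul, dotProduct, map_sum, map_mul, Finset.sum_mul]
    rw [Finset.sum_comm]
    refine Finset.sum_congr rfl fun k _ => ?_
    rw [← map_pow, ← hT k, map_sum, Finset.mul_sum]
    simp only [TF, Matrix.map_apply, ratFuncSubst_algebraMap, map_mul, mul_assoc, c]
  have hsum : ∑ j, a j * SF j i = c i := congrFun hc i
  obtain ⟨j, -, hj0, hj⟩ := exists_intDegree_sum_le Finset.univ (fun j => a j * SF j i)
    (by rw [hsum]; exact hi)
  rw [hsum] at hj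
  obtain ⟨haj, hSj⟩ := mul_ne_zero_iff.1 hj0
  rw [RatFunc.intDegree_mul haj hSj] at hj
  have hB : (SF j i).intDegree ≤ ((∑ i, ∑ j, (S i j).natDegree : ℕ) : ℤ) := by
    simp only [SF, Matrix.map_apply, ratFunc_intDegree_algebraMap]
    exact_mod_cast natDegree_le_sum_natDegree S j i
  obtain ⟨h0, hle⟩ := subst_combination hf a (fun h => haj (congrFun h j))
  rw [hval]
  refine ⟨h0, le_trans ?_ (hle j haj)⟩
  have : (H.coeff i).intDegree - ((∑ i, ∑ j, (S i j).natDegree : ℕ) : ℤ) ≤ (a j).intDegree := by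
    change (c i).intDegree - _ ≤ _
    omega
  have h2 := mul_le_mul_of_nonneg_left this (Int.natCast_nonneg f.natDegree)
  have h3 : (0 : ℤ) ≤ (j : ℕ) := Int.natCast_nonneg _
  linarith

/-- The degree function on `K(X)`, pulled back along the embedding `(f, g)` of the line. -/
theorem ramifiedDegree_ratEvalPair [CharZero K] (hgen : Function.Surjective (evalPair f g)) :
    RamifiedDegree (ratEvalPair f g hf) RatFunc.intDegree f.natDegree where
  map_mul _ _ hx hy := RatFunc.intDegree_mul hx hy
  map_add_le _ _ _ hy hxy := RatFunc.intDegree_add_le hy hxy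
  dvd_const a _ := by
    rw [ratEvalPair_C, intDegree_ratFuncSubst]
    exact dvd_mul_right _ _
  exists_const k := by
    obtain ⟨m, rfl | rfl⟩ := Int.eq_nat_or_neg k
    · refine ⟨ι (X ^ m), ratFunc_algebraMap_ne_zero (pow_ne_zero _ X_ne_zero), ?_⟩
      rw [ratEvalPair_C, intDegree_ratFuncSubst, ratFunc_intDegree_algebraMap, natDegree_X_pow]
    · refine ⟨(ι (X ^ m))⁻¹,
        inv_ne_zero (ratFunc_algebraMap_ne_zero (pow_ne_zero _ X_ne_zero)), ?_⟩
      rw [ratEvalPair_C, intDegree_ratFuncSubst, RatFunc.intDegree_inv,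
        ratFunc_intDegree_algebraMap, natDegree_X_pow]
  residue x y hx hy hxy := by
    obtain ⟨c, hc⟩ := exists_intDegree_sub_C_mul_lt hx hy hxy
    refine ⟨RatFunc.C c, ?_⟩
    rw [ratEvalPair_C, ratFuncSubst_C]
    exact hc
  map_ne_zero H hH hd := by
    obtain ⟨B, hB⟩ := ratEvalPair_ne_zero_and_le g hf hgen
    have hlt := (natDegree_lt_iff_degree_lt hH).2 hd
    exact (hB H hd ⟨H.natDegree, hlt⟩ (leadingCoeff_ne_zero.2 hH)).1
  map_natCast m hm := by
    rw [← map_natCast (RatFunc.C (K := K)), RatFunc.intDegree_C]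
  bddBelow := by
    obtain ⟨B, hB⟩ := ratEvalPair_ne_zero_and_le g hf hgen
    refine ⟨f.natDegree * (0 - B), fun H hH hd => ?_⟩
    have hlt := (natDegree_lt_iff_degree_lt hH.ne_zero).2 hd
    have := (hB H hd ⟨H.natDegree, hlt⟩ (leadingCoeff_ne_zero.2 hH.ne_zero)).2
    simpa [hH.coeff_natDegree] using this

/-- If `f` and `g` generate `K[X]` and `deg f ≥ 2`, then `g` can be brought to degree less than
that of `f` by adding a polynomial in `f`. -/
theorem exists_natDegree_add_comp_lt [CharZero K] (hf2 : 2 ≤ f.natDegree)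
    (hgen : Function.Surjective (evalPair f g)) :
    ∃ q : K[X], (g + q.comp f).natDegree < f.natDegree := by
  have hf : 0 < f.natDegree := by omega
  obtain ⟨P, hP, hPn, hP0⟩ := exists_monic_relation g hf
  obtain ⟨c, -, hc⟩ := exists_translate_lt (R := K[X]) (ρ := ι)
    (P := P) (fun m hm => by
      have : (m : K[X]) = C (m : K) := by simp
      rw [this]
      exact isUnit_C.2 (IsUnit.mk0 _ (Nat.cast_ne_zero.2 hm)))
    (ramifiedDegree_ratEvalPair g hf hgen) hP hPn (by rw [ratEvalPair_map, hP0, map_zero]) hf2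
    (fun a _ => by
      rw [ratEvalPair_C, ratFuncSubst_algebraMap, ratFunc_intDegree_algebraMap]
      exact Int.natCast_nonneg _)
    (fun k => by
      obtain ⟨H, hH⟩ := hgen (X ^ k)
      obtain ⟨H', hd, he⟩ := exists_degree_lt_evalPair_eq g hP hPn hP0 H
      refine ⟨H', hd, ?_⟩
      rw [ratEvalPair_map, he, hH, ratFunc_intDegree_algebraMap, natDegree_X_pow]
      exact ⟨ratFunc_algebraMap_ne_zero (pow_ne_zero _ X_ne_zero), rfl⟩)
  refine ⟨c, ?_⟩
  rw [map_add, ratEvalPair_X, ratEvalPair_C, ratFuncSubst_algebraMap, ← map_add,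
    ratFunc_intDegree_algebraMap] at hc
  exact_mod_cast hc

end Evaluation

section PlaneAutomorphisms

variable {K : Type*} [Field K]

/-- The shear `X ↦ X`, `Y ↦ Y + q(X)` of the plane. -/
noncomputable def shear (q : K[X]) : MvPolynomial (Fin 2) K ≃ₐ[K] MvPolynomial (Fin 2) K :=
  AlgEquiv.ofAlgHom
    (MvPolynomial.aeval ![MvPolynomial.X 0, MvPolynomial.X 1 + aeval (MvPolynomial.X 0) q])
    (MvPolynomial.aeval ![MvPolynomial.X 0, MvPolynomial.X 1 - aeval (MvPolynomial.X 0) q])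
    (MvPolynomial.algHom_ext fun i => by
      fin_cases i <;> simp [← Polynomial.aeval_algHom_apply])
    (MvPolynomial.algHom_ext fun i => by
      fin_cases i <;> simp [← Polynomial.aeval_algHom_apply])

lemma shear_X_zero (q : K[X]) : shear q (MvPolynomial.X 0) = MvPolynomial.X 0 := by
  simp [shear]

lemma shear_X_one (q : K[X]) :
    shear q (MvPolynomial.X 1) = MvPolynomial.X 1 + aeval (MvPolynomial.X 0) q := by
  simp [shear]

/-- The exchange of the two coordinates of the plane. -/
noncomputable def coordSwap : MvPolynomial (Fin 2) K ≃ₐ[K] MvPolynomial (Fin 2) K :=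
  MvPolynomial.renameEquiv K (Equiv.swap 0 1)

lemma coordSwap_X_zero : coordSwap (K := K) (MvPolynomial.X 0) = MvPolynomial.X 1 := by
  simp [coordSwap]

lemma coordSwap_X_one : coordSwap (K := K) (MvPolynomial.X 1) = MvPolynomial.X 0 := by
  simp [coordSwap]

/-- The embedded line given by `φ` is a coordinate line after an automorphism of the plane. -/
def IsRectifiable (φ : MvPolynomial (Fin 2) K →ₐ[K] K[X]) : Prop :=
  ∃ σ : MvPolynomial (Fin 2) K ≃ₐ[K] MvPolynomial (Fin 2) K,
    φ (σ (MvPolynomial.X 0)) = X ∧ φ (σ (MvPolynomial.X 1)) = 0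

variable {φ : MvPolynomial (Fin 2) K →ₐ[K] K[X]}

lemma IsRectifiable.of_comp (e : MvPolynomial (Fin 2) K ≃ₐ[K] MvPolynomial (Fin 2) K)
    (h : IsRectifiable (φ.comp e.toAlgHom)) : IsRectifiable φ := by
  obtain ⟨σ, h0, h1⟩ := h
  exact ⟨σ.trans e, h0, h1⟩

lemma surjective_comp_algEquiv (hφ : Function.Surjective φ)
    (e : MvPolynomial (Fin 2) K ≃ₐ[K] MvPolynomial (Fin 2) K) :
    Function.Surjective (φ.comp e.toAlgHom) := hφ.comp e.surjective

lemma comp_shear_X_zero (q : K[X]) :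
    φ.comp (shear q).toAlgHom (MvPolynomial.X 0) = φ (MvPolynomial.X 0) :=
  congrArg φ (shear_X_zero q)

lemma comp_shear_X_one (q : K[X]) :
    φ.comp (shear q).toAlgHom (MvPolynomial.X 1) =
      φ (MvPolynomial.X 1) + q.comp (φ (MvPolynomial.X 0)) := by
  refine (congrArg φ (shear_X_one q)).trans ?_
  rw [map_add, ← Polynomial.aeval_algHom_apply, comp_eq_aeval]

lemma comp_coordSwap_X_zero :
    φ.comp (coordSwap (K := K)).toAlgHom (MvPolynomial.X 0) = φ (MvPolynomial.X 1) :=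
  congrArg φ coordSwap_X_zero

lemma comp_coordSwap_X_one :
    φ.comp (coordSwap (K := K)).toAlgHom (MvPolynomial.X 1) = φ (MvPolynomial.X 0) :=
  congrArg φ coordSwap_X_one

lemma evalPair_surjective (hφ : Function.Surjective φ) :
    Function.Surjective (evalPair (φ (MvPolynomial.X 0)) (φ (MvPolynomial.X 1))) := by
  intro u
  obtain ⟨p, rfl⟩ := hφ u
  induction p using MvPolynomial.induction_on with
  | C a =>
    refine ⟨C (C a), ?_⟩
    rw [evalPair_C, C_comp]
    exact (φ.commutes a).symm
  | add p q hp hq =>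
    obtain ⟨H, hH⟩ := hp
    obtain ⟨G, hG⟩ := hq
    exact ⟨H + G, by rw [map_add, map_add, hH, hG]⟩
  | mul_X p i hp =>
    obtain ⟨H, hH⟩ := hp
    fin_cases i
    · exact ⟨H * C X, by simp [hH, evalPair_C]⟩
    · exact ⟨H * X, by simp [hH, evalPair_X]⟩

lemma evalPair_const (g : K[X]) (c : K) (H : K[X][X]) :
    evalPair g (C c) H = (H.eval (C c)).comp g := by
  have : evalPair g (C c) = (compRingHom g).comp (evalRingHom (C c)) := by
    refine Polynomial.ringHom_ext' (RingHom.ext fun a => ?_) ?_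
    · simp [evalPair_C]
    · simp [evalPair_X]
  exact RingHom.congr_fun this H

lemma natDegree_eq_one_of_natDegree_eq_zero (hφ : Function.Surjective φ)
    (h : (φ (MvPolynomial.X 1)).natDegree = 0) : (φ (MvPolynomial.X 0)).natDegree = 1 := by
  obtain ⟨H, hH⟩ := evalPair_surjective hφ X
  rw [eq_C_of_natDegree_eq_zero h, evalPair_const] at hH
  have := congrArg natDegree hH
  rw [natDegree_comp, natDegree_X] at this
  exact Nat.eq_one_of_mul_eq_one_left this

lemma exists_comp_eq_of_natDegree_eq_one {f : K[X]} (hf : f.natDegree = 1) (u : K[X]) :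
    ∃ q : K[X], q.comp f = u := by
  obtain ⟨a, ha⟩ := exists_subst_combination (f := f) (by omega) u
  refine ⟨a ⟨0, by omega⟩, ?_⟩
  rw [← ha, Finset.sum_eq_single ⟨0, by omega⟩]
  · simp
  · rintro ⟨b, hb⟩ _ hb0
    exact absurd (Fin.ext (by simp; omega)) hb0
  · simp

lemma isRectifiable_of_natDegree_eq_one (h : (φ (MvPolynomial.X 0)).natDegree = 1) :
    IsRectifiable φ := by
  obtain ⟨q, hq⟩ := exists_comp_eq_of_natDegree_eq_one h (X - φ (MvPolynomial.X 1))
  refine .of_comp (shear q) (.of_comp coordSwap (.of_comp (shear (-φ (MvPolynomial.X 0))) ?_))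
  refine ⟨AlgEquiv.refl, ?_, ?_⟩
  · simp only [AlgEquiv.coe_refl, id_eq, comp_shear_X_zero, comp_coordSwap_X_zero, comp_shear_X_one, hq]
    ring
  · simp only [AlgEquiv.coe_refl, id_eq, comp_shear_X_zero, comp_coordSwap_X_zero, comp_shear_X_one,
      comp_coordSwap_X_one, hq]
    simp

theorem isRectifiable_of_surjective [CharZero K] (hφ : Function.Surjective φ) :
    IsRectifiable φ := by
  induction hN : (φ (MvPolynomial.X 0)).natDegree using Nat.strong_induction_on
    generalizing φ with
  | _ N ih =>
  rcases lt_trichotomy N 1 with h | rfl | h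
  · refine .of_comp coordSwap (isRectifiable_of_natDegree_eq_one ?_)
    refine natDegree_eq_one_of_natDegree_eq_zero (surjective_comp_algEquiv hφ _) ?_
    rw [comp_coordSwap_X_one]
    omega
  · exact isRectifiable_of_natDegree_eq_one hN
  · obtain ⟨q, hq⟩ := exists_natDegree_add_comp_lt (φ (MvPolynomial.X 1))
      (f := φ (MvPolynomial.X 0)) (by omega) (evalPair_surjective hφ)
    refine .of_comp (shear q) (.of_comp coordSwap (ih _ (hq.trans_eq hN)
      (surjective_comp_algEquiv (surjective_comp_algEquiv hφ _) _) ?_))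
    rw [comp_coordSwap_X_zero, comp_shear_X_one]

end PlaneAutomorphisms

end AbhyankarMoh

open MvPolynomial

/-- **Abhyankar–Moh epimorphism theorem.**
Every surjective `ℂ`-algebra homomorphism `φ : ℂ[X,Y] → ℂ[t]` becomes, after a
polynomial change of coordinates `σ` of `ℂ[X,Y]`, the standard projection
`X ↦ t`, `Y ↦ 0`. -/
theorem abhyankar_moh_epimorphism
    (φ : MvPolynomial (Fin 2) ℂ →ₐ[ℂ] Polynomial ℂ)
    (hφ : Function.Surjective φ) :
    ∃ σ : MvPolynomial (Fin 2) ℂ ≃ₐ[ℂ] MvPolynomial (Fin 2) ℂ,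
      φ (σ (X 0)) = Polynomial.X ∧ φ (σ (X 1)) = 0 := by
  exact AbhyankarMoh.isRectifiable_of_surjective hφ
end
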